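/- Let C > 0 and b > 0. Let Ω ⊂ ℝ² be a normalized convex domain with 0 ∈ Ω, and let f be a smooth strictly convex function on Ω with inf_Ω f = 0 and f = C on ∂Ω, satisfying PDE (1.2) with parameter β = 0. Assume that 1/ρ ≤ b on Ω. Then there exists a constant α > 0 such that on Ω_{C/2} := {x ∈ Ω : f(x) < C/2} the estimates Φ/ρ^α ≤ d₄ and ‖grad f‖²/ρ^α ≤ d₄ hold for some constant d₄ > 0 depending only on α, b and C. -/

import Mathlib

open Real Filter Topology Matrix

noncomputable section

/-- The `i`-th partial derivative of `f`. -/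
def pd {n : ℕ} (i : Fin n) (f : (Fin n → ℝ) → ℝ) : (Fin n → ℝ) → ℝ :=
  fun x => fderiv ℝ f x (Pi.single i 1)

/-- The Hessian matrix `(∂²f/∂x_i∂x_j)` of `f` at `x`. -/
def hess {n : ℕ} (f : (Fin n → ℝ) → ℝ) (x : Fin n → ℝ) : Matrix (Fin n) (Fin n) ℝ :=
  Matrix.of fun i j => pd i (pd j f) x

/-- The gradient vector of `f` at `x`. -/
def gradv {n : ℕ} (f : (Fin n → ℝ) → ℝ) (x : Fin n → ℝ) : Fin n → ℝ :=
  fun i => pd i f x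

/-- `ρ := (det (f_ij))^(-1/(n+2))`. -/
def rho {n : ℕ} (f : (Fin n → ℝ) → ℝ) (x : Fin n → ℝ) : ℝ :=
  (hess f x).det ^ (-(1 : ℝ) / ((n : ℝ) + 2))

/-- The squared norm `‖grad h‖² = ∑ f^{ij} h_i h_j` with respect to the Calabi metric of `f`. -/
def gradSq {n : ℕ} (f h : (Fin n → ℝ) → ℝ) (x : Fin n → ℝ) : ℝ :=
  ∑ i, ∑ j, (hess f x)⁻¹ i j * pd i h x * pd j h x

/-- The Laplacian `Δh = (1/√det)(∑ ∂_i(√det · f^{ij} ∂_j h))` with respect to the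
Calabi metric of `f`. -/
def calabiLap {n : ℕ} (f h : (Fin n → ℝ) → ℝ) (x : Fin n → ℝ) : ℝ :=
  (Real.sqrt (hess f x).det)⁻¹ *
    ∑ i, ∑ j, pd i (fun y => Real.sqrt (hess f y).det * (hess f y)⁻¹ i j * pd j h y) x

/-- `Φ := ‖grad ρ‖²/ρ²`. -/
def Phi {n : ℕ} (f : (Fin n → ℝ) → ℝ) (x : Fin n → ℝ) : ℝ :=
  gradSq f (rho f) x / (rho f x) ^ 2

/-- PDE (1.2): `Δρ = -β ‖grad ρ‖²/ρ` on `Ω`. -/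
def PDE2 {n : ℕ} (f : (Fin n → ℝ) → ℝ) (β : ℝ) (Ω : Set (Fin n → ℝ)) : Prop :=
  ∀ x ∈ Ω, calabiLap f (rho f) x = -β * gradSq f (rho f) x / rho f x

/-- The cofactor matrix of a square matrix. -/
def cof {n : ℕ} (H : Matrix (Fin n) (Fin n) ℝ) : Matrix (Fin n) (Fin n) ℝ :=
  (Matrix.adjugate H)ᵀ

/-- PDE (1.1): `∑ F^{ij} w_ij = 0` with `w = (det (f_ij))^a` on `Ω`, where `(F^{ij})`
is the cofactor matrix of the Hessian of `f`. -/
def PDE1 {n : ℕ} (f : (Fin n → ℝ) → ℝ) (a : ℝ) (Ω : Set (Fin n → ℝ)) : Prop :=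
  ∀ x ∈ Ω, ∑ i, ∑ j,
    cof (hess f x) i j * pd i (pd j fun y => (hess f y).det ^ a) x = 0

/-- `f` is a quadratic polynomial on `ℝ²`. -/
def IsQuadratic (f : (Fin 2 → ℝ) → ℝ) : Prop :=
  ∃ (Q : Matrix (Fin 2) (Fin 2) ℝ) (b : Fin 2 → ℝ) (c : ℝ),
    ∀ x, f x = (∑ i, ∑ j, Q i j * x i * x j) + (∑ i, b i * x i) + c

/-- Euclidean open ball of radius `r` centered at `0` in `ℝ²`. -/
def ebal (r : ℝ) : Set (Fin 2 → ℝ) := {x | (x 0) ^ 2 + (x 1) ^ 2 < r ^ 2}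

/-- Euclidean norm on `ℝ²`. -/
def enorm2 (x : Fin 2 → ℝ) : ℝ := Real.sqrt ((x 0) ^ 2 + (x 1) ^ 2)

/-- A normalized convex domain: `B_{2^{-3/2}}(0) ⊆ Ω ⊆ B_1(0)`. -/
def NormalizedDomain (Ω : Set (Fin 2 → ℝ)) : Prop :=
  IsOpen Ω ∧ Convex ℝ Ω ∧ ebal ((2 : ℝ) ^ (-(3 : ℝ) / 2)) ⊆ Ω ∧ Ω ⊆ ebal 1

/-- The class `𝒮(Ω,C)`: smooth strictly convex functions on `Ω` with `inf f = 0` and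
`f = C` on `∂Ω`. -/
def SClass (Ω : Set (Fin 2 → ℝ)) (C : ℝ) (f : (Fin 2 → ℝ) → ℝ) : Prop :=
  ContDiffOn ℝ (⊤ : ℕ∞) f Ω ∧ (∀ x ∈ Ω, (hess f x).PosDef) ∧
    sInf (f '' Ω) = 0 ∧ ContinuousOn f (closure Ω) ∧ ∀ x ∈ frontier Ω, f x = C

/-- `u` is the Legendre transform function of `f` relative to `0`:
`u(∇f(x)) = ⟨x, ∇f(x)⟩ - f(x)`. -/
def LegendreOf (Ω : Set (Fin 2 → ℝ)) (f u : (Fin 2 → ℝ) → ℝ) : Prop :=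
  ∀ x ∈ Ω, u (gradv f x) = (∑ i, x i * gradv f x i) - f x

end


namespace CalabiEstimate

/-- The derivative of `h` in the constant direction `e`. -/
noncomputable def dd (e : Fin 2 → ℝ) (h : (Fin 2 → ℝ) → ℝ) : (Fin 2 → ℝ) → ℝ :=
  fun x => fderiv ℝ h x e

/-- `φ` is differentiable near `0`, with value `a`, derivative `b` and second derivative `c`
at `0`. -/
def Jet (φ : ℝ → ℝ) (a b c : ℝ) : Prop :=
  ∃ φ' : ℝ → ℝ, (∀ᶠ t in 𝓝 (0 : ℝ), HasDerivAt φ (φ' t) t) ∧ φ 0 = a ∧ φ' 0 = b ∧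
    HasDerivAt φ' c 0

namespace Jet

variable {φ ψ : ℝ → ℝ} {a b c a' b' c' : ℝ}

lemma congr_val (h : Jet φ a b c) (ha : a = a') (hb : b = b') (hc : c = c') :
    Jet φ a' b' c' := by subst ha hb hc; exact h

lemma const (k : ℝ) : Jet (fun _ => k) k 0 0 :=
  ⟨fun _ => 0, Eventually.of_forall fun t => hasDerivAt_const t k, rfl, rfl,
    hasDerivAt_const _ _⟩

lemma add (h : Jet φ a b c) (h' : Jet ψ a' b' c') :
    Jet (fun t => φ t + ψ t) (a + a') (b + b') (c + c') := by
  obtain ⟨φ', h1, h2, h3, h4⟩ := h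
  obtain ⟨ψ', k1, k2, k3, k4⟩ := h'
  refine ⟨fun t => φ' t + ψ' t, ?_, by simp only [h2, k2], by simp only [h3, k3], h4.add k4⟩
  filter_upwards [h1, k1] with t ht kt using ht.add kt

lemma mul (h : Jet φ a b c) (h' : Jet ψ a' b' c') :
    Jet (fun t => φ t * ψ t) (a * a') (b * a' + a * b') (c * a' + 2 * (b * b') + a * c') := by
  obtain ⟨φ', h1, h2, h3, h4⟩ := h
  obtain ⟨ψ', k1, k2, k3, k4⟩ := h'
  refine ⟨fun t => φ' t * ψ t + φ t * ψ' t, ?_, by simp only [h2, k2], by simp only [h2, k2, h3, k3], ?_⟩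
  · filter_upwards [h1, k1] with t ht kt using ht.mul kt
  · have := (h4.mul k1.self_of_nhds).add (h1.self_of_nhds.mul k4)
    refine this.congr_deriv ?_
    rw [h2, k2, h3, k3]; ring

lemma const_mul (k : ℝ) (h : Jet φ a b c) :
    Jet (fun t => k * φ t) (k * a) (k * b) (k * c) :=
  ((const k).mul h).congr_val rfl (by ring) (by ring)

lemma sub (h : Jet φ a b c) (h' : Jet ψ a' b' c') :
    Jet (fun t => φ t - ψ t) (a - a') (b - b') (c - c') := by
  have := h.add (h'.const_mul (-1))
  have e : (fun t => φ t - ψ t) = fun t => φ t + -1 * ψ t := by ext; ring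
  rw [e]
  exact this.congr_val (by ring) (by ring) (by ring)

lemma exp (h : Jet φ a b c) :
    Jet (fun t => Real.exp (φ t)) (Real.exp a) (Real.exp a * b)
      (Real.exp a * (b ^ 2 + c)) := by
  obtain ⟨φ', h1, h2, h3, h4⟩ := h
  refine ⟨fun t => Real.exp (φ t) * φ' t, ?_, by simp only [h2], by simp only [h2, h3], ?_⟩
  · filter_upwards [h1] with t ht using ht.exp
  · refine (h1.self_of_nhds.exp.mul h4).congr_deriv ?_
    rw [h2, h3]; ring

lemma log (h : Jet φ a b c) (ha : 0 < a) :
    Jet (fun t => Real.log (φ t)) (Real.log a) (b / a) (c / a - (b / a) ^ 2) := by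
  obtain ⟨φ', h1, h2, h3, h4⟩ := h
  have hc : ContinuousAt φ 0 := h1.self_of_nhds.continuousAt
  have hpos : ∀ᶠ t in 𝓝 (0 : ℝ), 0 < φ t :=
    hc.eventually (lt_mem_nhds (by rw [h2]; exact ha))
  refine ⟨fun t => φ' t / φ t, ?_, by simp only [h2], by simp only [h2, h3], ?_⟩
  · filter_upwards [h1, hpos] with t ht hp using ht.log hp.ne'
  · have h0 : φ 0 ≠ 0 := by rw [h2]; exact ha.ne'
    refine (h4.div h1.self_of_nhds h0).congr_deriv ?_
    rw [h2, h3]; field_simp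

lemma eq_zero_and_nonpos (h : Jet φ a b c) (hm : IsLocalMax φ 0) : b = 0 ∧ c ≤ 0 := by
  obtain ⟨φ', h1, h2, h3, h4⟩ := h
  have hd : b = 0 := by
    rw [← h3]; exact hm.hasDerivAt_eq_zero h1.self_of_nhds
  refine ⟨hd, ?_⟩
  by_contra! hc
  have hderiv : deriv φ =ᶠ[𝓝 0] φ' := by
    filter_upwards [h1] with t ht using ht.deriv
  have hdd : deriv (deriv φ) 0 = c := by rw [hderiv.deriv_eq]; exact h4.deriv
  have hmin : IsLocalMin φ 0 := isLocalMin_of_deriv_deriv_pos (by rw [hdd]; exact hc)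
    (by rw [hderiv.self_of_nhds, h3, hd]) h1.self_of_nhds.continuousAt
  have hconst : φ =ᶠ[𝓝 0] fun _ => φ 0 := by
    filter_upwards [hm, hmin] with t h1 h2 using le_antisymm h1 h2
  have : deriv (deriv φ) 0 = 0 := by
    have h5 : deriv φ =ᶠ[𝓝 0] fun _ => 0 := by
      have := hconst.deriv
      simpa using this
    rw [h5.deriv_eq]; simp
  linarith

end Jet

section Smooth

variable {Ω : Set (Fin 2 → ℝ)} {h g : (Fin 2 → ℝ) → ℝ} {x : Fin 2 → ℝ}

lemma contDiffOn_dd (hΩ : IsOpen Ω) (hh : ContDiffOn ℝ (⊤ : ℕ∞) h Ω) (e : Fin 2 → ℝ) :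
    ContDiffOn ℝ (⊤ : ℕ∞) (dd e h) Ω :=
  (hh.fderiv_of_isOpen hΩ (by simp)).clm_apply contDiffOn_const

lemma differentiableAt_of_contDiffOn (hΩ : IsOpen Ω) (hh : ContDiffOn ℝ (⊤ : ℕ∞) h Ω)
    (hx : x ∈ Ω) : DifferentiableAt ℝ h x :=
  (hh.contDiffAt (hΩ.mem_nhds hx)).differentiableAt (by simp)

lemma eventually_line_mem (hΩ : IsOpen Ω) (hx : x ∈ Ω) (e : Fin 2 → ℝ) :
    ∀ᶠ t in 𝓝 (0 : ℝ), x + t • e ∈ Ω := by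
  have hc : ContinuousAt (fun t : ℝ => x + t • e) 0 := by fun_prop
  exact hc.eventually (hΩ.mem_nhds (by simpa using hx))

lemma hasDerivAt_line (hΩ : IsOpen Ω) (hh : ContDiffOn ℝ (⊤ : ℕ∞) h Ω) (e : Fin 2 → ℝ)
    {t : ℝ} (ht : x + t • e ∈ Ω) :
    HasDerivAt (fun s : ℝ => h (x + s • e)) (dd e h (x + t • e)) t := by
  have h1 := (differentiableAt_of_contDiffOn hΩ hh ht).hasFDerivAt
  have h2 : HasDerivAt (fun s : ℝ => x + s • e) e t := by
    simpa using ((hasDerivAt_id t).smul_const e).const_add x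
  exact h1.comp_hasDerivAt t h2

lemma hasDerivAt_line_zero (hΩ : IsOpen Ω) (hh : ContDiffOn ℝ (⊤ : ℕ∞) h Ω) (e : Fin 2 → ℝ)
    (hx : x ∈ Ω) :
    HasDerivAt (fun s : ℝ => h (x + s • e)) (dd e h x) 0 := by
  simpa using hasDerivAt_line (x := x) (t := 0) hΩ hh e (by simpa using hx)

lemma jet_line (hΩ : IsOpen Ω) (hh : ContDiffOn ℝ (⊤ : ℕ∞) h Ω) (e : Fin 2 → ℝ)
    (hx : x ∈ Ω) :
    Jet (fun t : ℝ => h (x + t • e)) (h x) (dd e h x) (dd e (dd e h) x) := by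
  refine ⟨fun t => dd e h (x + t • e), ?_, by simp, by simp,
    hasDerivAt_line_zero hΩ (contDiffOn_dd hΩ hh e) e hx⟩
  filter_upwards [eventually_line_mem hΩ hx e] with t ht using hasDerivAt_line hΩ hh e ht

lemma dd_congr (hΩ : IsOpen Ω) (hhg : ∀ y ∈ Ω, h y = g y) (e : Fin 2 → ℝ) :
    ∀ y ∈ Ω, dd e h y = dd e g y := fun y hy => by
  have : h =ᶠ[𝓝 y] g := by
    filter_upwards [hΩ.mem_nhds hy] with z hz using hhg z hz
  simp only [dd, this.fderiv_eq]

lemma dd_comm (hΩ : IsOpen Ω) (hh : ContDiffOn ℝ (⊤ : ℕ∞) h Ω) (e e' : Fin 2 → ℝ) :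
    ∀ y ∈ Ω, dd e (dd e' h) y = dd e' (dd e h) y := fun y hy => by
  have hs : IsSymmSndFDerivAt ℝ h y :=
    (hh.contDiffAt (hΩ.mem_nhds hy)).isSymmSndFDerivAt (by
      simp only [minSmoothness_of_isRCLikeNormedField]; exact WithTop.coe_le_coe.2 (le_top : (2 : ℕ∞) ≤ ⊤))
  have hd : DifferentiableAt ℝ (fderiv ℝ h) y :=
    ((hh.fderiv_of_isOpen (m := (⊤ : ℕ∞)) hΩ (by simp)).contDiffAt
      (hΩ.mem_nhds hy)).differentiableAt (by simp)
  have key : ∀ a b : Fin 2 → ℝ, dd a (dd b h) y = fderiv ℝ (fderiv ℝ h) y a b := by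
    intro a b
    have := (hd.hasFDerivAt.clm_apply (hasFDerivAt_const b y)).fderiv
    have h2 : dd b h = fun y => fderiv ℝ h y b := rfl
    rw [dd, h2]
    refine (congrArg (fun L => L a) this).trans ?_
    simp
  rw [key, key, hs.eq]

lemma dd_eq_pd (e : Fin 2 → ℝ) (h : (Fin 2 → ℝ) → ℝ) (y : Fin 2 → ℝ) :
    dd e h y = e 0 * pd 0 h y + e 1 * pd 1 h y := by
  have he : e = e 0 • Pi.single 0 1 + e 1 • Pi.single 1 1 := by
    ext i; fin_cases i <;> simp
  unfold dd pd
  conv_lhs => rw [he]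
  rw [map_add, map_smul, map_smul]; simp

lemma dd_dd_eq_pd (hΩ : IsOpen Ω) (hh : ContDiffOn ℝ (⊤ : ℕ∞) h Ω) (e e' : Fin 2 → ℝ) :
    ∀ y ∈ Ω, dd e (dd e' h) y = e 0 * e' 0 * pd 0 (pd 0 h) y
      + (e 0 * e' 1 + e 1 * e' 0) * pd 0 (pd 1 h) y + e 1 * e' 1 * pd 1 (pd 1 h) y := by
  intro y hy
  have h1 : dd e' h = fun y => e' 0 * pd 0 h y + e' 1 * pd 1 h y := by
    ext y; exact dd_eq_pd e' h y
  have hd : ∀ i, DifferentiableAt ℝ (pd i h) y := fun i =>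
    differentiableAt_of_contDiffOn hΩ (contDiffOn_dd hΩ hh _) hy
  have h2 : ∀ i, pd i (dd e' h) y = e' 0 * pd i (pd 0 h) y + e' 1 * pd i (pd 1 h) y := by
    intro i
    rw [h1]
    have := (((hd 0).hasFDerivAt.const_mul (e' 0)).add
      ((hd 1).hasFDerivAt.const_mul (e' 1))).fderiv
    rw [pd]
    erw [this]
    simp [pd]
  rw [dd_eq_pd, h2, h2]
  have h3 : pd 0 (pd 1 h) y = pd 1 (pd 0 h) y := dd_comm hΩ hh _ _ y hy
  rw [← h3]; ring

end Smooth

section Algebra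

lemma frobenius_lower_bound (p1 p2 u11 u12 u22 A11 A12 A22 y1 y2 : ℝ) :
    (u11 ^ 2 + 2 * u12 ^ 2 + u22 ^ 2) / 4 - 41 * (p1 ^ 2 + p2 ^ 2) ^ 2
      - 2 * (A11 ^ 2 + 2 * A12 ^ 2 + A22 ^ 2)
      - 16 * (p1 ^ 2 + p2 ^ 2) * (y1 ^ 2 + y2 ^ 2) ≤
    (A11 ^ 2 + 2 * A12 ^ 2 + A22 ^ 2) - 8 * (u11 * p1 ^ 2 + 2 * u12 * p1 * p2 + u22 * p2 ^ 2)
      - 2 * (A11 * u11 + 2 * A12 * u12 + A22 * u22) + 2 * (u11 ^ 2 + 2 * u12 ^ 2 + u22 ^ 2)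
      + 6 * (A11 * p1 ^ 2 + 2 * A12 * p1 * p2 + A22 * p2 ^ 2)
      + 2 * ((2 * (u11 * p1 + u12 * p2) - (A11 * p1 + A12 * p2)) * y1
        + (2 * (u12 * p1 + u22 * p2) - (A12 * p1 + A22 * p2)) * y2)
      + (p1 ^ 2 + p2 ^ 2) * (y1 ^ 2 + y2 ^ 2) := by
  linarith [sq_nonneg (A11 - u11), sq_nonneg (A12 - u12), sq_nonneg (A22 - u22),
    sq_nonneg (u11 - 8 * p1 * p1), sq_nonneg (u12 - 8 * p1 * p2), sq_nonneg (u22 - 8 * p2 * p2),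
    sq_nonneg (A11 + 3 * p1 * p1), sq_nonneg (A12 + 3 * p1 * p2), sq_nonneg (A22 + 3 * p2 * p2),
    sq_nonneg (u11 + 8 * p1 * y1), sq_nonneg (u12 + 8 * p1 * y2), sq_nonneg (u12 + 8 * p2 * y1),
    sq_nonneg (u22 + 8 * p2 * y2),
    sq_nonneg (A11 - p1 * y1), sq_nonneg (A12 - p1 * y2), sq_nonneg (A12 - p2 * y1),
    sq_nonneg (A22 - p2 * y2)]

lemma cubic_contraction_bound (p1 p2 t1 t2 : ℝ) :
    (t1 * p1 + t2 * p2) ^ 2 + 2 * (t2 * p1 + (-4 * p1 - t1) * p2) ^ 2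
      + ((-4 * p1 - t1) * p1 + (-4 * p2 - t2) * p2) ^ 2 ≤
    (p1 ^ 2 + p2 ^ 2) * (7 * (t1 ^ 2 + t2 ^ 2) + 96 * (p1 ^ 2 + p2 ^ 2)) := by
  have cs : ∀ a b : ℝ, (a * p1 + b * p2) ^ 2 ≤ (p1 ^ 2 + p2 ^ 2) * (a ^ 2 + b ^ 2) := by
    intro a b; linarith [sq_nonneg (a * p2 - b * p1)]
  have h1 := cs t1 t2
  have h2 := cs t2 (-4 * p1 - t1)
  have h3 := cs (-4 * p1 - t1) (-4 * p2 - t2)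
  have hp : 0 ≤ p1 ^ 2 + p2 ^ 2 := by positivity
  have h4 : (t1 ^ 2 + t2 ^ 2) + 2 * (t2 ^ 2 + (-4 * p1 - t1) ^ 2)
      + ((-4 * p1 - t1) ^ 2 + (-4 * p2 - t2) ^ 2) ≤
      7 * (t1 ^ 2 + t2 ^ 2) + 96 * (p1 ^ 2 + p2 ^ 2) := by
    linarith [sq_nonneg (4 * p1 - t1), sq_nonneg (4 * p2 - t2), sq_nonneg p2, sq_nonneg t2]
  linarith [mul_le_mul_of_nonneg_left h4 hp]

lemma gradient_contraction_bound (p1 p2 u11 u12 u22 A11 A12 A22 : ℝ) :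
    (2 * (u11 * p1 + u12 * p2) - (A11 * p1 + A12 * p2)) ^ 2
      + (2 * (u12 * p1 + u22 * p2) - (A12 * p1 + A22 * p2)) ^ 2 ≤
    (p1 ^ 2 + p2 ^ 2) * (8 * (u11 ^ 2 + 2 * u12 ^ 2 + u22 ^ 2)
      + 2 * (A11 ^ 2 + 2 * A12 ^ 2 + A22 ^ 2)) := by
  have cs : ∀ a b : ℝ, (a * p1 + b * p2) ^ 2 ≤ (p1 ^ 2 + p2 ^ 2) * (a ^ 2 + b ^ 2) := by
    intro a b; linarith [sq_nonneg (a * p2 - b * p1)]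
  have sq2 : ∀ a b : ℝ, (2 * a - b) ^ 2 ≤ 8 * a ^ 2 + 2 * b ^ 2 := by
    intro a b; linarith [sq_nonneg (2 * a + b)]
  linarith [sq2 (u11 * p1 + u12 * p2) (A11 * p1 + A12 * p2),
    sq2 (u12 * p1 + u22 * p2) (A12 * p1 + A22 * p2),
    cs u11 u12, cs u12 u22, cs A11 A12, cs A12 A22]

lemma le_of_mul_sub_le {α q δ : ℝ} (hα : 10 ^ 7 ≤ α) (hq : 0 < q) (hδ : 0 < δ)
    (h : 9 / 10 * α * (q / δ) ^ 2 ≤ 201 / 100 * α * (1 / δ) + 18 * (1 / q) ^ 2) :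
    q ^ 2 ≤ 3 * δ := by
  by_contra! hc
  have h1 : 9 / 10 * α * (q ^ 2) ^ 2 ≤ 201 / 100 * α * δ * q ^ 2 + 18 * δ ^ 2 := by
    have := mul_le_mul_of_nonneg_right h (by positivity : 0 ≤ q ^ 2 * δ ^ 2)
    have e1 : 9 / 10 * α * (q / δ) ^ 2 * (q ^ 2 * δ ^ 2) = 9 / 10 * α * (q ^ 2) ^ 2 := by
      field_simp
    have e2 : (201 / 100 * α * (1 / δ) + 18 * (1 / q) ^ 2) * (q ^ 2 * δ ^ 2)
        = 201 / 100 * α * δ * q ^ 2 + 18 * δ ^ 2 := by field_simp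
    rw [e1, e2] at this; exact this
  have hα0 : 0 < α := by linarith
  have hQ : 0 < q ^ 2 := by positivity
  have h2 : 3 * δ * (α * q ^ 2) < q ^ 2 * (α * q ^ 2) :=
    mul_lt_mul_of_pos_right hc (by positivity)
  have h3 : 3 * δ * (α * δ) ≤ q ^ 2 * (α * δ) :=
    mul_le_mul_of_nonneg_right hc.le (by positivity)
  have h4 : 10 ^ 7 * δ ^ 2 ≤ α * δ ^ 2 := mul_le_mul_of_nonneg_right hα (by positivity)
  have h5 : 0 < δ ^ 2 := by positivity
  nlinarith

set_option maxHeartbeats 1000000 in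
/-- The algebraic core of the gradient estimate: the first and second order conditions at an
interior maximum bound `‖grad f‖² = q²`. -/
lemma grad_bound_of_critical (α q δ w p1 p2 u11 u12 u22 t1 t2 A11 A12 A22 y1 y2 G1 G2 Φ LΦ : ℝ)
    (hα : 10 ^ 7 ≤ α) (hq : 0 < q) (hδ : 0 < δ) (hw : 0 < w)
    (hΦ : Φ = p1 ^ 2 + p2 ^ 2)
    (hA11 : A11 = t1 * p1 + t2 * p2) (hA12 : A12 = t2 * p1 + (-4 * p1 - t1) * p2)
    (hA22 : A22 = (-4 * p1 - t1) * p1 + (-4 * p2 - t2) * p2)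
    (hy1 : y1 = -α * p1 - α * (q / δ)) (hy2 : y2 = -α * p2)
    (hG1 : G1 = 2 * (u11 * p1 + u12 * p2) - (A11 * p1 + A12 * p2))
    (hG2 : G2 = 2 * (u12 * p1 + u22 * p2) - (A12 * p1 + A22 * p2))
    (hL : LΦ = (A11 ^ 2 + 2 * A12 ^ 2 + A22 ^ 2)
      - 8 * (u11 * p1 ^ 2 + 2 * u12 * p1 * p2 + u22 * p2 ^ 2)
      - 2 * (A11 * u11 + 2 * A12 * u12 + A22 * u22) + 2 * (u11 ^ 2 + 2 * u12 ^ 2 + u22 ^ 2)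
      + 6 * (A11 * p1 ^ 2 + 2 * A12 * p1 * p2 + A22 * p2 ^ 2))
    (hH : w * Φ ≤ 1 / 1000) (hwr : 1 ≤ 8000 * (q / δ) ^ 2 * w)
    (F1 : 2 * (1 / q) - t1 - α * p1 - (α - 2) * (q / δ) + w * (G1 + Φ * y1) = 0)
    (F2 : -t2 - α * p2 + w * (G2 + Φ * y2) = 0)
    (S : (4 * p1 + t1) ^ 2 + t2 ^ 2 + 4 * u11 + 8 * p1 * (1 / q) + 4 * t1 * (1 / q)
      + 3 * α * Φ - 2 * (α - 2) * (1 / δ) - (α - 2) * (q / δ) ^ 2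
      + w * (LΦ + 2 * (G1 * y1 + G2 * y2)
        + Φ * (y1 ^ 2 + y2 ^ 2 + 3 * α * Φ - 2 * α * (1 / δ) - α * (q / δ) ^ 2)) ≤ 0) :
    q ^ 2 ≤ 3 * δ := by
  apply le_of_mul_sub_le hα hq hδ
  have hid : 0 < 1 / δ := by positivity
  set i : ℝ := 1 / q with hi
  set r : ℝ := q / δ with hr
  set d : ℝ := 1 / δ with hd
  have hα0 : 0 < α := by linarith
  have hΦ0 : 0 ≤ Φ := by rw [hΦ]; positivity
  set U : ℝ := u11 ^ 2 + 2 * u12 ^ 2 + u22 ^ 2 with hU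
  have hU0 : 0 ≤ U := by positivity
  set τ : ℝ := t1 ^ 2 + t2 ^ 2 with hτ
  have hτ0 : 0 ≤ τ := by positivity
  set Y : ℝ := y1 ^ 2 + y2 ^ 2 with hY
  have hY0 : 0 ≤ Y := by positivity
  set N : ℝ := A11 ^ 2 + 2 * A12 ^ 2 + A22 ^ 2 with hN
  set H : ℝ := w * Φ with hHdef
  have hH0 : 0 ≤ H := by positivity
  have hwU : 0 ≤ w * U := by positivity
  have b1 := frobenius_lower_bound p1 p2 u11 u12 u22 A11 A12 A22 y1 y2
  rw [← hΦ, ← hU, ← hN, ← hY] at b1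
  have b2 : N ≤ Φ * (7 * τ + 96 * Φ) := by
    have := cubic_contraction_bound p1 p2 t1 t2
    rw [← hA11, ← hA12, ← hA22, ← hΦ] at this; exact this
  have b3 : G1 ^ 2 + G2 ^ 2 ≤ Φ * (8 * U + 2 * N) := by
    have := gradient_contraction_bound p1 p2 u11 u12 u22 A11 A12 A22
    rw [← hG1, ← hG2, ← hΦ] at this; exact this
  rw [← hG1, ← hG2] at b1
  have b4 : U / 4 - 41 * Φ ^ 2 - 2 * N - 16 * Φ * Y ≤ LΦ + 2 * (G1 * y1 + G2 * y2) + Φ * Y := by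
    rw [hL]; exact b1
  have hHτ : H * τ ≤ 1 / 1000 * τ := mul_le_mul_of_nonneg_right hH hτ0
  have hHΦ : H * Φ ≤ 1 / 1000 * Φ := mul_le_mul_of_nonneg_right hH hΦ0
  have hHY : H * Y ≤ 1 / 1000 * Y := mul_le_mul_of_nonneg_right hH hY0
  have b5 : w * U / 4 - 1 / 4 * Φ - 14 / 1000 * τ - 16 / 1000 * Y ≤
      w * (LΦ + 2 * (G1 * y1 + G2 * y2) + Φ * Y) := by
    have h1 := mul_le_mul_of_nonneg_left b4 hw.le
    have h2 := mul_le_mul_of_nonneg_left b2 hw.le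
    have e2 : w * (Φ * (7 * τ + 96 * Φ)) = 7 * (H * τ) + 96 * (H * Φ) := by rw [hHdef]; ring
    have e1 : w * (U / 4 - 41 * Φ ^ 2 - 2 * N - 16 * Φ * Y) =
      w * U / 4 - 41 * (H * Φ) - 2 * (w * N) - 16 * (H * Y) := by rw [hHdef]; ring
    rw [e2] at h2; rw [e1] at h1
    linarith
  have hwG : w ^ 2 * (G1 ^ 2 + G2 ^ 2) ≤ 8 / 1000 * (w * U) + 1 / 1000 * τ + 1 / 1000 * Φ := by
    have h1 := mul_le_mul_of_nonneg_left b3 (sq_nonneg w)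
    have h2 := mul_le_mul_of_nonneg_left b2 hw.le
    have e1 : w ^ 2 * (Φ * (8 * U + 2 * N)) = H * (8 * (w * U) + 2 * (w * N)) := by
      rw [hHdef]; ring
    have e2 : w * (Φ * (7 * τ + 96 * Φ)) = 7 * (H * τ) + 96 * (H * Φ) := by rw [hHdef]; ring
    have h3 : 8 * (w * U) + 2 * (w * N) ≤ 8 * (w * U) + 14 / 1000 * τ + 192 / 1000 * Φ := by
      rw [e2] at h2; linarith
    have h4 := mul_le_mul_of_nonneg_left h3 hH0
    have h5 : H * (8 * (w * U) + 14 / 1000 * τ + 192 / 1000 * Φ) ≤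
        1 / 1000 * (8 * (w * U) + 14 / 1000 * τ + 192 / 1000 * Φ) :=
      mul_le_mul_of_nonneg_right hH (by positivity)
    rw [e1] at h1
    linarith
  have hYb : Y ≤ 4 * (τ + 4 * i ^ 2 + 4 * r ^ 2 + w ^ 2 * (G1 ^ 2 + G2 ^ 2)) := by
    have k1 : (1 + H) * y1 = t1 - 2 * i - 2 * r - w * G1 := by
      rw [hHdef]; linear_combination F1 + hy1
    have k2 : (1 + H) * y2 = t2 - w * G2 := by
      rw [hHdef]; linear_combination F2 + hy2
    have k3 : Y ≤ ((1 + H) * y1) ^ 2 + ((1 + H) * y2) ^ 2 := by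
      have : ((1 + H) * y1) ^ 2 + ((1 + H) * y2) ^ 2 = Y + (2 * H + H ^ 2) * Y := by
        rw [hY]; ring
      rw [this]
      have : 0 ≤ (2 * H + H ^ 2) * Y := by positivity
      linarith
    rw [k1, k2] at k3
    have sq4 : ∀ a b c e : ℝ, (a - b - c - e) ^ 2 ≤ 4 * (a ^ 2 + b ^ 2 + c ^ 2 + e ^ 2) := by
      intro a b c e
      linarith [sq_nonneg (a + b), sq_nonneg (a + c), sq_nonneg (a + e), sq_nonneg (b - c),
        sq_nonneg (b - e), sq_nonneg (c - e)]
    have k4 := sq4 t1 (2 * i) (2 * r) (w * G1)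
    have k5 := sq4 t2 0 0 (w * G2)
    have k6 : t2 - 0 - 0 - w * G2 = t2 - w * G2 := by ring
    rw [k6] at k5
    rw [hτ]
    linarith
  have hΦr : α * Φ ≥ 3 / 4 * α * r ^ 2 - 3 / 1000 * Y := by
    have k1 : 3 / 4 * r ^ 2 * α ^ 2 - 3 * Y ≤ Φ * α ^ 2 := by
      rw [hΦ, hY, hy1, hy2]
      linarith [sq_nonneg (4 * α * p1 + 3 * α * r), sq_nonneg (α * p2)]
    have k2 : 3 * Y ≤ 3 / 1000 * Y * α := by
      linarith [mul_le_mul_of_nonneg_left hα hY0]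
    have k3 : (3 / 4 * α * r ^ 2 - 3 / 1000 * Y) * α ≤ (α * Φ) * α := by linarith
    exact le_of_mul_le_mul_right k3 hα0
  have hu : 4 * u11 ≥ -(w * U / 8) - 256000 * r ^ 2 := by
    have k1 : 0 ≤ (w * u11 + 16) ^ 2 := sq_nonneg _
    have k2 : w * (-(w * U / 8) - 256000 * r ^ 2) ≤ w * (4 * u11) := by
      have : w * w * u11 ^ 2 ≤ w * w * U := by
        apply mul_le_mul_of_nonneg_left _ (by positivity)
        rw [hU]; linarith [sq_nonneg u12, sq_nonneg u22]
      linarith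
    exact le_of_mul_le_mul_left k2 hw
  have hsq1 : (4 * p1 + t1) ^ 2 ≥ 1 / 2 * t1 ^ 2 - 16 * Φ := by
    rw [hΦ]; linarith [sq_nonneg (8 * p1 + t1), sq_nonneg p2]
  have hsq2 : 8 * p1 * i ≥ -(16 * Φ) - i ^ 2 := by
    rw [hΦ]; linarith [sq_nonneg (4 * p1 + i), sq_nonneg p2]
  have hsq3 : 4 * t1 * i ≥ -(1 / 4 * t1 ^ 2) - 16 * i ^ 2 := by
    linarith [sq_nonneg (t1 / 2 + 4 * i)]
  have hHL : w * (Φ * (3 * α * Φ - 2 * α * d - α * r ^ 2)) ≥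
      - (1 / 1000) * (2 * α * d + α * r ^ 2) := by
    have e : w * (Φ * (3 * α * Φ - 2 * α * d - α * r ^ 2)) =
      H * (3 * α * Φ) - H * (2 * α * d + α * r ^ 2) := by rw [hHdef]; ring
    have k1 : 0 ≤ H * (3 * α * Φ) := by positivity
    have k2 : H * (2 * α * d + α * r ^ 2) ≤ 1 / 1000 * (2 * α * d + α * r ^ 2) :=
      mul_le_mul_of_nonneg_right hH (by positivity)
    linarith
  have hαr : 10 ^ 7 * r ^ 2 ≤ α * r ^ 2 := mul_le_mul_of_nonneg_right hα (sq_nonneg r)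
  have hαΦ : 10 ^ 7 * Φ ≤ α * Φ := mul_le_mul_of_nonneg_right hα hΦ0
  have e0 : w * (LΦ + 2 * (G1 * y1 + G2 * y2)
        + Φ * (Y + 3 * α * Φ - 2 * α * d - α * r ^ 2)) =
      w * (LΦ + 2 * (G1 * y1 + G2 * y2) + Φ * Y) +
        w * (Φ * (3 * α * Φ - 2 * α * d - α * r ^ 2)) := by ring
  rw [e0] at S
  have hτe : t2 ^ 2 = τ - t1 ^ 2 := by rw [hτ]; ring
  have ht1 : t1 ^ 2 ≤ τ := by rw [hτ]; linarith [sq_nonneg t2]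
  have hr0 : 0 ≤ r ^ 2 := sq_nonneg r
  have hi0 : 0 ≤ i ^ 2 := sq_nonneg i
  have hdd : 0 ≤ α * d := by positivity
  linarith

end Algebra

section Frame

/-- The form `f₂₂ h₁² - 2 f₁₂ h₁ h₂ + f₁₁ h₂²`, with derivatives taken along `e₁`, `e₂`. -/
noncomputable def frameN (e₁ e₂ : Fin 2 → ℝ) (f h : (Fin 2 → ℝ) → ℝ) (y : Fin 2 → ℝ) : ℝ :=
  dd e₂ (dd e₂ f) y * (dd e₁ h y * dd e₁ h y)
    - 2 * (dd e₁ (dd e₂ f) y * (dd e₁ h y * dd e₂ h y))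
    + dd e₁ (dd e₁ f) y * (dd e₂ h y * dd e₂ h y)

/-- The Hessian determinant of `f` in the frame `e₁`, `e₂`. -/
noncomputable def frameD (e₁ e₂ : Fin 2 → ℝ) (f : (Fin 2 → ℝ) → ℝ) (y : Fin 2 → ℝ) : ℝ :=
  dd e₁ (dd e₁ f) y * dd e₂ (dd e₂ f) y - dd e₁ (dd e₂ f) y * dd e₁ (dd e₂ f) y

/-- The second order operator `f₂₂ h₁₁ - 2 f₁₂ h₁₂ + f₁₁ h₂₂` in the frame `e₁`, `e₂`. -/
noncomputable def frameL (e₁ e₂ : Fin 2 → ℝ) (f h : (Fin 2 → ℝ) → ℝ) (y : Fin 2 → ℝ) : ℝ :=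
  dd e₂ (dd e₂ f) y * dd e₁ (dd e₁ h) y
    - 2 * (dd e₁ (dd e₂ f) y * dd e₁ (dd e₂ h) y)
    + dd e₁ (dd e₁ f) y * dd e₂ (dd e₂ h) y

/-- The derivative of the Hessian determinant along `e`, expanded by the product rule. -/
noncomputable def frameD' (e e₁ e₂ : Fin 2 → ℝ) (f : (Fin 2 → ℝ) → ℝ) (y : Fin 2 → ℝ) : ℝ :=
  dd e (dd e₁ (dd e₁ f)) y * dd e₂ (dd e₂ f) y + dd e₁ (dd e₁ f) y * dd e (dd e₂ (dd e₂ f)) y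
    - 2 * (dd e₁ (dd e₂ f) y * dd e (dd e₁ (dd e₂ f)) y)

/-- The values at a point of the derivatives of `u = log ρ` (`p`, `u`) and of `f`
(`q`, `t`, `s`, of orders one, three and four). -/
structure FrameCoeffs where
  (p1 p2 q1 q2 u11 u12 u22 u111 u112 u122 u222 t111 t112 t122 t222
    s1111 s1112 s1122 s1222 s2222 : ℝ)

/-- In the frame `e₁`, `e₂`, orthonormal for the Hessian of `f` at `x`, the derivatives of
`f` and `u` at `x` are given by `c`. -/
structure IsFrame (c : FrameCoeffs) (e₁ e₂ : Fin 2 → ℝ) (f u : (Fin 2 → ℝ) → ℝ)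
    (x : Fin 2 → ℝ) : Prop where
  f11_1 : Jet (fun t => dd e₁ (dd e₁ f) (x + t • e₁)) 1 c.t111 c.s1111
  f12_1 : Jet (fun t => dd e₁ (dd e₂ f) (x + t • e₁)) 0 c.t112 c.s1112
  f22_1 : Jet (fun t => dd e₂ (dd e₂ f) (x + t • e₁)) 1 c.t122 c.s1122
  f11_2 : Jet (fun t => dd e₁ (dd e₁ f) (x + t • e₂)) 1 c.t112 c.s1122
  f12_2 : Jet (fun t => dd e₁ (dd e₂ f) (x + t • e₂)) 0 c.t122 c.s1222
  f22_2 : Jet (fun t => dd e₂ (dd e₂ f) (x + t • e₂)) 1 c.t222 c.s2222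
  f1_1 : Jet (fun t => dd e₁ f (x + t • e₁)) c.q1 1 c.t111
  f2_1 : Jet (fun t => dd e₂ f (x + t • e₁)) c.q2 0 c.t112
  f1_2 : Jet (fun t => dd e₁ f (x + t • e₂)) c.q1 0 c.t122
  f2_2 : Jet (fun t => dd e₂ f (x + t • e₂)) c.q2 1 c.t222
  f_1 : Jet (fun t => f (x + t • e₁)) (f x) c.q1 1
  f_2 : Jet (fun t => f (x + t • e₂)) (f x) c.q2 1
  u1_1 : Jet (fun t => dd e₁ u (x + t • e₁)) c.p1 c.u11 c.u111
  u2_1 : Jet (fun t => dd e₂ u (x + t • e₁)) c.p2 c.u12 c.u112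
  u1_2 : Jet (fun t => dd e₁ u (x + t • e₂)) c.p1 c.u12 c.u122
  u2_2 : Jet (fun t => dd e₂ u (x + t • e₂)) c.p2 c.u22 c.u222
  u_1 : Jet (fun t => u (x + t • e₁)) (u x) c.p1 c.u11
  u_2 : Jet (fun t => u (x + t • e₂)) (u x) c.p2 c.u22
  trace1 : c.t111 + c.t122 = -4 * c.p1
  trace2 : c.t112 + c.t222 = -4 * c.p2
  ricci11 : -4 * c.u11 - 4 * c.p1 * (c.t111 + c.t122) =
    c.s1111 + 2 * (c.t111 * c.t122) + c.s1122 - 2 * c.t112 ^ 2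
  ricci12 : -4 * c.u12 - 4 * c.p1 * (c.t112 + c.t222) =
    c.s1112 + c.t111 * c.t222 + c.t112 * c.t122 + c.s1222 - 2 * (c.t112 * c.t122)
  ricci22 : -4 * c.u22 - 4 * c.p2 * (c.t112 + c.t222) =
    c.s1122 + 2 * (c.t112 * c.t222) + c.s2222 - 2 * c.t122 ^ 2
  pde : c.u11 + c.u22 + 3 * (c.p1 ^ 2 + c.p2 ^ 2) = 0
  pde1 : c.t122 * c.u11 - 2 * c.t112 * c.u12 + c.t111 * c.u22 + c.u111 + c.u122
    + 3 * (c.t122 * c.p1 ^ 2 - 2 * c.t112 * c.p1 * c.p2 + c.t111 * c.p2 ^ 2)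
    + 6 * (c.p1 * c.u11 + c.p2 * c.u12) = 0
  pde2 : c.t222 * c.u11 - 2 * c.t122 * c.u12 + c.t112 * c.u22 + c.u112 + c.u222
    + 3 * (c.t222 * c.p1 ^ 2 - 2 * c.t122 * c.p1 * c.p2 + c.t112 * c.p2 ^ 2)
    + 6 * (c.p1 * c.u12 + c.p2 * c.u22) = 0

lemma Jet.deriv_eq_zero {φ : ℝ → ℝ} {a b c : ℝ} (h : Jet φ a b c)
    (h0 : ∀ᶠ t in 𝓝 (0 : ℝ), φ t = 0) : b = 0 := by
  refine (h.eq_zero_and_nonpos ?_).1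
  filter_upwards [h0] with t ht
  rw [ht, h0.self_of_nhds]

lemma exists_isFrame {Ω : Set (Fin 2 → ℝ)} {f u : (Fin 2 → ℝ) → ℝ} {e₁ e₂ x : Fin 2 → ℝ}
    (hΩ : IsOpen Ω) (hf : ContDiffOn ℝ (⊤ : ℕ∞) f Ω) (hu : ContDiffOn ℝ (⊤ : ℕ∞) u Ω)
    (hx : x ∈ Ω)
    (hD₁ : ∀ y ∈ Ω, -4 * (dd e₁ u y * frameD e₁ e₂ f y) = frameD' e₁ e₁ e₂ f y)
    (hD₂ : ∀ y ∈ Ω, -4 * (dd e₂ u y * frameD e₁ e₂ f y) = frameD' e₂ e₁ e₂ f y)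
    (hP : ∀ y ∈ Ω, frameL e₁ e₂ f u y + 3 * frameN e₁ e₂ f u y = 0)
    (h11 : dd e₁ (dd e₁ f) x = 1) (h12 : dd e₁ (dd e₂ f) x = 0)
    (h22 : dd e₂ (dd e₂ f) x = 1) :
    ∃ c : FrameCoeffs, IsFrame c e₁ e₂ f u x ∧ c.p1 = dd e₁ u x ∧ c.p2 = dd e₂ u x ∧
      c.q1 = dd e₁ f x ∧ c.q2 = dd e₂ f x := by
  have sm := @contDiffOn_dd Ω
  have f1 := contDiffOn_dd hΩ hf e₁
  have f2 := contDiffOn_dd hΩ hf e₂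
  have f11 := contDiffOn_dd hΩ f1 e₁
  have f12 := contDiffOn_dd hΩ f2 e₁
  have f22 := contDiffOn_dd hΩ f2 e₂
  have u1 := contDiffOn_dd hΩ hu e₁
  have u2 := contDiffOn_dd hΩ hu e₂
  have u11 := contDiffOn_dd hΩ u1 e₁
  have u12 := contDiffOn_dd hΩ u2 e₁
  have u22 := contDiffOn_dd hΩ u2 e₂
  have cf := dd_comm hΩ hf e₂ e₁
  have cu := dd_comm hΩ hu e₂ e₁
  -- third derivatives
  have a1 : ∀ y ∈ Ω, dd e₁ (dd e₁ (dd e₂ f)) y = dd e₂ (dd e₁ (dd e₁ f)) y := fun y hy => by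
    rw [dd_comm hΩ f1 e₂ e₁ y hy]
    exact (dd_congr hΩ cf e₁ y hy).symm
  have a2 : ∀ y ∈ Ω, dd e₂ (dd e₁ (dd e₂ f)) y = dd e₁ (dd e₂ (dd e₂ f)) y := fun y hy =>
    dd_comm hΩ f2 e₂ e₁ y hy
  have b1 : ∀ y ∈ Ω, dd e₁ (dd e₁ (dd e₂ u)) y = dd e₂ (dd e₁ (dd e₁ u)) y := fun y hy => by
    rw [dd_comm hΩ u1 e₂ e₁ y hy]
    exact (dd_congr hΩ cu e₁ y hy).symm
  have b2 : ∀ y ∈ Ω, dd e₂ (dd e₁ (dd e₂ u)) y = dd e₁ (dd e₂ (dd e₂ u)) y := fun y hy =>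
    dd_comm hΩ u2 e₂ e₁ y hy
  have b3 : ∀ y ∈ Ω, dd e₂ (dd e₂ (dd e₁ u)) y = dd e₁ (dd e₂ (dd e₂ u)) y := fun y hy => by
    rw [← b2 y hy]; exact dd_congr hΩ cu e₂ y hy
  have a3 : ∀ y ∈ Ω, dd e₂ (dd e₂ (dd e₁ f)) y = dd e₁ (dd e₂ (dd e₂ f)) y := fun y hy => by
    rw [← a2 y hy]; exact dd_congr hΩ cf e₂ y hy
  -- fourth derivatives
  have c1 : dd e₁ (dd e₁ (dd e₂ (dd e₂ f))) x = dd e₂ (dd e₂ (dd e₁ (dd e₁ f))) x := by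
    rw [← dd_congr hΩ a2 e₁ x hx, dd_comm hΩ f12 e₁ e₂ x hx]
    exact dd_congr hΩ a1 e₂ x hx
  have c2 : dd e₁ (dd e₁ (dd e₁ (dd e₂ f))) x = dd e₂ (dd e₁ (dd e₁ (dd e₁ f))) x := by
    rw [dd_congr hΩ a1 e₁ x hx, dd_comm hΩ f11 e₁ e₂ x hx]
  have c3 : dd e₂ (dd e₁ (dd e₁ (dd e₂ f))) x = dd e₂ (dd e₂ (dd e₁ (dd e₁ f))) x :=
    dd_congr hΩ a1 e₂ x hx
  have c4 : dd e₂ (dd e₂ (dd e₁ (dd e₂ f))) x = dd e₂ (dd e₁ (dd e₂ (dd e₂ f))) x :=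
    dd_congr hΩ a2 e₂ x hx
  have J := fun {h : (Fin 2 → ℝ) → ℝ} (hh : ContDiffOn ℝ (⊤ : ℕ∞) h Ω) (e : Fin 2 → ℝ) =>
    jet_line hΩ hh e hx
  have t1 := hD₁ x hx
  have t2 := hD₂ x hx
  have t3 := hP x hx
  simp only [frameD, frameD', frameL, frameN, h11, h12, h22, a1 x hx, a2 x hx] at t1 t2 t3
  have ev : ∀ {g : (Fin 2 → ℝ) → ℝ} (hg : ∀ y ∈ Ω, g y = 0) (e : Fin 2 → ℝ),
      ∀ᶠ t in 𝓝 (0 : ℝ), g (x + t • e) = 0 := fun hg e => by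
    filter_upwards [eventually_line_mem hΩ hx e] with t ht using hg _ ht
  have jD : ∀ e : Fin 2 → ℝ, Jet (fun t => frameD e₁ e₂ f (x + t • e)) _ _ _ := fun e =>
    ((J f11 e).mul (J f22 e)).sub ((J f12 e).mul (J f12 e))
  have jD' : ∀ e' e : Fin 2 → ℝ, Jet (fun t => frameD' e' e₁ e₂ f (x + t • e)) _ _ _ :=
    fun e' e => (((J (sm hΩ f11 e') e).mul (J f22 e)).add
      ((J f11 e).mul (J (sm hΩ f22 e') e))).sub
      (((J f12 e).mul (J (sm hΩ f12 e') e)).const_mul 2)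
  have jN : ∀ e : Fin 2 → ℝ, Jet (fun t => frameN e₁ e₂ f u (x + t • e)) _ _ _ := fun e =>
    ((((J f22 e).mul ((J u1 e).mul (J u1 e))).sub
      (((J f12 e).mul ((J u1 e).mul (J u2 e))).const_mul 2))).add
      ((J f11 e).mul ((J u2 e).mul (J u2 e)))
  have jL : ∀ e : Fin 2 → ℝ, Jet (fun t => frameL e₁ e₂ f u (x + t • e)) _ _ _ := fun e =>
    ((((J f22 e).mul (J u11 e)).sub
      (((J f12 e).mul (J u12 e)).const_mul 2))).add
      ((J f11 e).mul (J u22 e))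
  have r11 := ((((J u1 e₁).mul (jD e₁)).const_mul (-4)).sub (jD' e₁ e₁)).deriv_eq_zero
    (ev (g := fun y => -4 * (dd e₁ u y * frameD e₁ e₂ f y) - frameD' e₁ e₁ e₂ f y)
      (fun y hy => sub_eq_zero.2 (hD₁ y hy)) e₁)
  have r12 := ((((J u1 e₂).mul (jD e₂)).const_mul (-4)).sub (jD' e₁ e₂)).deriv_eq_zero
    (ev (g := fun y => -4 * (dd e₁ u y * frameD e₁ e₂ f y) - frameD' e₁ e₁ e₂ f y)
      (fun y hy => sub_eq_zero.2 (hD₁ y hy)) e₂)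
  have r22 := ((((J u2 e₂).mul (jD e₂)).const_mul (-4)).sub (jD' e₂ e₂)).deriv_eq_zero
    (ev (g := fun y => -4 * (dd e₂ u y * frameD e₁ e₂ f y) - frameD' e₂ e₁ e₂ f y)
      (fun y hy => sub_eq_zero.2 (hD₂ y hy)) e₂)
  have q1 := ((jL e₁).add ((jN e₁).const_mul 3)).deriv_eq_zero
    (ev (g := fun y => frameL e₁ e₂ f u y + 3 * frameN e₁ e₂ f u y) hP e₁)
  have q2 := ((jL e₂).add ((jN e₂).const_mul 3)).deriv_eq_zero
    (ev (g := fun y => frameL e₁ e₂ f u y + 3 * frameN e₁ e₂ f u y) hP e₂)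
  simp only [h11, h12, h22, a1 x hx, a2 x hx, b1 x hx, b2 x hx, c1, c2, c3, c4,
    cu x hx] at r11 r12 r22 q1 q2
  refine ⟨⟨dd e₁ u x, dd e₂ u x, dd e₁ f x, dd e₂ f x, dd e₁ (dd e₁ u) x, dd e₁ (dd e₂ u) x,
    dd e₂ (dd e₂ u) x, dd e₁ (dd e₁ (dd e₁ u)) x, dd e₂ (dd e₁ (dd e₁ u)) x,
    dd e₁ (dd e₂ (dd e₂ u)) x, dd e₂ (dd e₂ (dd e₂ u)) x,
    dd e₁ (dd e₁ (dd e₁ f)) x, dd e₂ (dd e₁ (dd e₁ f)) x,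
    dd e₁ (dd e₂ (dd e₂ f)) x, dd e₂ (dd e₂ (dd e₂ f)) x,
    dd e₁ (dd e₁ (dd e₁ (dd e₁ f))) x, dd e₂ (dd e₁ (dd e₁ (dd e₁ f))) x,
    dd e₂ (dd e₂ (dd e₁ (dd e₁ f))) x, dd e₂ (dd e₁ (dd e₂ (dd e₂ f))) x,
    dd e₂ (dd e₂ (dd e₂ (dd e₂ f))) x⟩, ?_, rfl, rfl, rfl, rfl⟩
  constructor
  · exact (J f11 e₁).congr_val h11 rfl rfl
  · exact (J f12 e₁).congr_val h12 (a1 x hx) c2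
  · exact (J f22 e₁).congr_val h22 rfl c1
  · exact (J f11 e₂).congr_val h11 rfl rfl
  · exact (J f12 e₂).congr_val h12 (a2 x hx) c4
  · exact (J f22 e₂).congr_val h22 rfl rfl
  · exact (J f1 e₁).congr_val rfl h11 rfl
  · exact (J f2 e₁).congr_val rfl h12 (a1 x hx)
  · exact (J f1 e₂).congr_val rfl ((cf x hx).trans h12) (a3 x hx)
  · exact (J f2 e₂).congr_val rfl h22 rfl
  · exact (J hf e₁).congr_val rfl rfl h11
  · exact (J hf e₂).congr_val rfl rfl h22
  · exact J u1 e₁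
  · exact (J u2 e₁).congr_val rfl rfl (b1 x hx)
  · exact (J u1 e₂).congr_val rfl (cu x hx) (b3 x hx)
  · exact J u2 e₂
  · exact J hu e₁
  · exact J hu e₂
  · simp only; linarith
  · simp only; linarith
  · simp only; linarith
  · simp only; linarith
  · simp only; linarith
  · simp only; linarith
  · simp only; linarith
  · simp only; linarith

end Frame

section Maximum

variable {c : FrameCoeffs} {e₁ e₂ x : Fin 2 → ℝ} {f u : (Fin 2 → ℝ) → ℝ}

/-- The two-jet of `frameN` along a line, in an orthonormal frame. -/
lemma Jet.frameForm {F₁ F₂ F₃ h₁ h₂ : ℝ → ℝ} {a a' b b' c c' g₁ g₁' g₁'' g₂ g₂' g₂'' : ℝ}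
    (k₁ : Jet F₁ 1 a a') (k₂ : Jet F₂ 0 b b') (k₃ : Jet F₃ 1 c c')
    (l₁ : Jet h₁ g₁ g₁' g₁'') (l₂ : Jet h₂ g₂ g₂' g₂'') :
    Jet (fun t => F₃ t * (h₁ t * h₁ t) - 2 * (F₂ t * (h₁ t * h₂ t)) + F₁ t * (h₂ t * h₂ t))
      (g₁ ^ 2 + g₂ ^ 2)
      (c * g₁ ^ 2 - 2 * b * g₁ * g₂ + a * g₂ ^ 2 + 2 * g₁ * g₁' + 2 * g₂ * g₂')
      (c' * g₁ ^ 2 - 2 * b' * g₁ * g₂ + a' * g₂ ^ 2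
        + 2 * (2 * c * g₁ * g₁' - 2 * b * (g₁' * g₂ + g₁ * g₂') + 2 * a * g₂ * g₂')
        + 2 * g₁' ^ 2 + 2 * g₁ * g₁'' + 2 * g₂' ^ 2 + 2 * g₂ * g₂'') :=
  (((k₃.mul (l₁.mul l₁)).sub ((k₂.mul (l₁.mul l₂)).const_mul 2)).add
    (k₁.mul (l₂.mul l₂))).congr_val (by ring) (by ring) (by ring)

lemma isLocalMax_line {h : (Fin 2 → ℝ) → ℝ} (hm : IsLocalMax h x) (e : Fin 2 → ℝ) :
    IsLocalMax (fun t : ℝ => h (x + t • e)) 0 := by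
  have hc : Tendsto (fun t : ℝ => x + t • e) (𝓝 0) (𝓝 x) := by
    have : ContinuousAt (fun t : ℝ => x + t • e) 0 := by fun_prop
    simpa [ContinuousAt] using this
  have := hc.eventually hm
  simpa [IsLocalMax, IsMaxFilter] using this

lemma Phi_bound_algebra {α δ p q₁ q₂ t₁ t₂ u₁₁ : ℝ} (hα : 0 < α)
    (hF : 2 * p * u₁₁ - t₁ * p ^ 2 - α * p ^ 3 - α * p ^ 2 * (q₁ / δ) = 0) (hp : p ≠ 0)
    (hS : t₂ ^ 2 + (4 * p + t₁) ^ 2 - 4 * u₁₁ - 6 * p ^ 2 + 3 * α * p ^ 2 - 2 * α / δ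
      - α * ((q₁ / δ) ^ 2 + (q₂ / δ) ^ 2) ≤ 0) :
    p ^ 2 ≤ 4 / δ + 6 * ((q₁ / δ) ^ 2 + (q₂ / δ) ^ 2) := by
  have hu : 2 * u₁₁ = t₁ * p + α * p ^ 2 + α * p * (q₁ / δ) := by
    have : p * (2 * u₁₁ - (t₁ * p + α * p ^ 2 + α * p * (q₁ / δ))) = 0 := by
      linear_combination hF
    rcases mul_eq_zero.1 this with h | h
    · exact absurd h hp
    · linarith
  have e : 2 * α / δ = 2 * α * (1 / δ) := by ring
  have e' : 4 / δ = 4 * (1 / δ) := by ring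
  rw [e] at hS
  rw [e']
  set r₁ := q₁ / δ
  set r₂ := q₂ / δ
  set d := 1 / δ
  have h1 : α * p ^ 2 ≤ α * (2 * d + 2 * (p * r₁) + r₁ ^ 2 + r₂ ^ 2) := by
    linarith [sq_nonneg (t₁ + 3 * p), sq_nonneg t₂, sq_nonneg p]
  have h2 := le_of_mul_le_mul_left h1 hα
  linarith [sq_nonneg (p - 2 * r₁), sq_nonneg r₁, sq_nonneg r₂]

/-- At an interior maximum of `log (Φ ρ^{-α} (C - f)^α)`, the norm of `grad f` controls `Φ`. -/
lemma IsFrame.Phi_bound (hc : IsFrame c e₁ e₂ f u x) (hp : c.p1 ≠ 0) (hp2 : c.p2 = 0)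
    {α C δ : ℝ} (hα : 0 < α) (hδ : C - f x = δ) (hδ0 : 0 < δ)
    (hm : IsLocalMax (fun y => Real.log (frameN e₁ e₂ f u y) + (4 - α) * u y
      + α * Real.log (C - f y)) x) :
    c.p1 ^ 2 ≤ 4 / δ + 6 * ((c.q1 / δ) ^ 2 + (c.q2 / δ) ^ 2) := by
  have hN : 0 < c.p1 ^ 2 + c.p2 ^ 2 := by positivity
  have hδ' : 0 < C - f x := by rw [hδ]; exact hδ0
  obtain ⟨m1, m1'⟩ := Jet.eq_zero_and_nonpos
    (((((hc.f11_1.frameForm hc.f12_1 hc.f22_1 hc.u1_1 hc.u2_1).log hN).add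
      (hc.u_1.const_mul (4 - α))).add
      ((((Jet.const C).sub hc.f_1).log hδ').const_mul α))) (isLocalMax_line hm e₁)
  obtain ⟨m2, m2'⟩ := Jet.eq_zero_and_nonpos
    (((((hc.f11_2.frameForm hc.f12_2 hc.f22_2 hc.u1_2 hc.u2_2).log hN).add
      (hc.u_2.const_mul (4 - α))).add
      ((((Jet.const C).sub hc.f_2).log hδ').const_mul α))) (isLocalMax_line hm e₂)
  rw [hδ] at m1 m1' m2 m2'
  have k1 := hc.trace1
  have k2 := hc.trace2
  have k3 := hc.ricci22
  have k4 := hc.pde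
  have k5 := hc.pde1
  clear hm hc
  obtain ⟨p1, p2, q1, q2, u11, u12, u22, u111, u112, u122, u222, t111, t112, t122, t222,
    s1111, s1112, s1122, s1222, s2222⟩ := c
  simp only at *
  subst hp2
  obtain rfl : t122 = -4 * p1 - t111 := by linarith
  obtain rfl : t222 = -t112 := by linarith
  obtain rfl : u22 = -3 * p1 ^ 2 - u11 := by linarith
  refine Phi_bound_algebra (t₁ := t111) (t₂ := t112) (u₁₁ := u11) hα ?_ hp ?_
  · field_simp at m1 ⊢
    linear_combination m1
  · obtain rfl : s2222 = -4 * (-3 * p1 ^ 2 - u11) - s1122 - 2 * (t112 * -t112)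
        + 2 * (-4 * p1 - t111) ^ 2 := by linarith
    obtain rfl : u122 = -u111 - ((-4 * p1 - t111) * u11 - 2 * t112 * u12
        + t111 * (-3 * p1 ^ 2 - u11) + 3 * (-4 * p1 - t111) * p1 ^ 2 + 6 * p1 * u11) := by
      linarith
    refine le_of_eq_of_le ?_ (add_nonpos m1' m2')
    field_simp
    ring

/-- At an interior maximum of
`log (‖grad f‖² ρ^{-α} (C - f)^{α - 2}) + μ Φ ρ^{-α} (C - f)^α`,
the norm of `grad f` is bounded in terms of `C - f`. -/
lemma IsFrame.grad_bound (hc : IsFrame c e₁ e₂ f u x) (hq : 0 < c.q1) (hq2 : c.q2 = 0)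
    {α C δ μ w : ℝ} (hα : 10 ^ 7 ≤ α) (hδ : C - f x = δ) (hδ0 : 0 < δ) (hμ : 0 < μ)
    (hw : w = μ * Real.exp ((4 - α) * u x + α * Real.log δ))
    (hH : w * (c.p1 ^ 2 + c.p2 ^ 2) ≤ 1 / 1000) (hwr : 1 ≤ 8000 * (c.q1 / δ) ^ 2 * w)
    (hm : IsLocalMax (fun y => Real.log (frameN e₁ e₂ f f y) + (4 - α) * u y
      + (α - 2) * Real.log (C - f y)
      + μ * (frameN e₁ e₂ f u y * Real.exp ((4 - α) * u y + α * Real.log (C - f y)))) x) :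
    c.q1 ^ 2 ≤ 3 * δ := by
  have hN : 0 < c.q1 ^ 2 + c.q2 ^ 2 := by positivity
  have hδ' : 0 < C - f x := by rw [hδ]; exact hδ0
  have z1 := (hc.u_1.const_mul (4 - α)).add ((((Jet.const C).sub hc.f_1).log hδ').const_mul α)
  have z2 := (hc.u_2.const_mul (4 - α)).add ((((Jet.const C).sub hc.f_2).log hδ').const_mul α)
  obtain ⟨m1, m1'⟩ := Jet.eq_zero_and_nonpos
    (((((hc.f11_1.frameForm hc.f12_1 hc.f22_1 hc.f1_1 hc.f2_1).log hN).add
      (hc.u_1.const_mul (4 - α))).add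
      ((((Jet.const C).sub hc.f_1).log hδ').const_mul (α - 2))).add
      (((hc.f11_1.frameForm hc.f12_1 hc.f22_1 hc.u1_1 hc.u2_1).mul z1.exp).const_mul μ))
    (isLocalMax_line hm e₁)
  obtain ⟨m2, m2'⟩ := Jet.eq_zero_and_nonpos
    (((((hc.f11_2.frameForm hc.f12_2 hc.f22_2 hc.f1_2 hc.f2_2).log hN).add
      (hc.u_2.const_mul (4 - α))).add
      ((((Jet.const C).sub hc.f_2).log hδ').const_mul (α - 2))).add
      (((hc.f11_2.frameForm hc.f12_2 hc.f22_2 hc.u1_2 hc.u2_2).mul z2.exp).const_mul μ))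
    (isLocalMax_line hm e₂)
  clear z1 z2
  rw [hδ] at m1 m1' m2 m2'
  have hw0 : 0 < w := by rw [hw]; positivity
  set E := Real.exp ((4 - α) * u x + α * Real.log δ)
  have k1 := hc.trace1
  have k2 := hc.trace2
  have k3 := hc.ricci22
  have k3' := hc.ricci12
  have k3'' := hc.ricci11
  have k4 := hc.pde
  have k5 := hc.pde1
  have k6 := hc.pde2
  clear hm hc
  obtain ⟨p1, p2, q1, q2, u11, u12, u22, u111, u112, u122, u222, t111, t112, t122, t222,
    s1111, s1112, s1122, s1222, s2222⟩ := c
  simp only at *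
  subst hq2
  obtain rfl : t122 = -4 * p1 - t111 := by linarith
  obtain rfl : t222 = -4 * p2 - t112 := by linarith
  obtain rfl : u22 = -3 * (p1 ^ 2 + p2 ^ 2) - u11 := by linarith
  refine grad_bound_of_critical α q1 δ w p1 p2 u11 u12 (-3 * (p1 ^ 2 + p2 ^ 2) - u11)
    t111 t112 _ _ _ _ _ _ _ _ _ hα hq hδ0 hw0 rfl rfl rfl rfl rfl rfl rfl rfl rfl hH hwr ?_ ?_ ?_
  · rw [← m1, hw]
    field_simp
    ring
  · rw [← m2, hw]
    field_simp
    ring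
  · obtain rfl : s2222 = -4 * (-3 * (p1 ^ 2 + p2 ^ 2) - u11) + 16 * p2 ^ 2 - s1122
        - 2 * (t112 * (-4 * p2 - t112)) + 2 * (-4 * p1 - t111) ^ 2 := by linarith
    obtain rfl : s1111 = -4 * u11 + 16 * p1 ^ 2 - 2 * (t111 * (-4 * p1 - t111)) - s1122
        + 2 * t112 ^ 2 := by linarith
    obtain rfl : s1222 = -4 * u12 + 16 * p1 * p2 - s1112 - t111 * (-4 * p2 - t112)
        + t112 * (-4 * p1 - t111) := by linarith
    obtain rfl : u122 = -u111 - ((-4 * p1 - t111) * u11 - 2 * t112 * u12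
        + t111 * (-3 * (p1 ^ 2 + p2 ^ 2) - u11)
        + 3 * ((-4 * p1 - t111) * p1 ^ 2 - 2 * t112 * p1 * p2 + t111 * p2 ^ 2)
        + 6 * (p1 * u11 + p2 * u12)) := by
      linarith
    obtain rfl : u222 = -u112 - ((-4 * p2 - t112) * u11 - 2 * (-4 * p1 - t111) * u12
        + t112 * (-3 * (p1 ^ 2 + p2 ^ 2) - u11)
        + 3 * ((-4 * p2 - t112) * p1 ^ 2 - 2 * (-4 * p1 - t111) * p1 * p2 + t112 * p2 ^ 2)
        + 6 * (p1 * u12 + p2 * (-3 * (p1 ^ 2 + p2 ^ 2) - u11))) := by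
      linarith
    refine le_of_eq_of_le ?_ (add_nonpos m1' m2')
    rw [hw]
    field_simp
    ring

end Maximum

section Coordinates

variable {Ω : Set (Fin 2 → ℝ)} {f g h u : (Fin 2 → ℝ) → ℝ} {x : Fin 2 → ℝ}

lemma dd_eq_of_hasDerivAt {e : Fin 2 → ℝ} {b : ℝ} (hd : DifferentiableAt ℝ h x)
    (hb : HasDerivAt (fun t : ℝ => h (x + t • e)) b 0) : dd e h x = b := by
  rw [dd, ← hd.lineDeriv_eq_fderiv]
  exact hb.deriv

lemma dd_mul (hΩ : IsOpen Ω) (hh : ContDiffOn ℝ (⊤ : ℕ∞) h Ω) (hg : ContDiffOn ℝ (⊤ : ℕ∞) g Ω)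
    (hx : x ∈ Ω) (e : Fin 2 → ℝ) :
    dd e (fun y => h y * g y) x = dd e h x * g x + h x * dd e g x := by
  refine dd_eq_of_hasDerivAt (differentiableAt_of_contDiffOn hΩ (hh.mul hg) hx) ?_
  have := (hasDerivAt_line_zero hΩ hh e hx).mul (hasDerivAt_line_zero hΩ hg e hx)
  simp only [zero_smul, add_zero] at this
  exact this

lemma dd_sub (hΩ : IsOpen Ω) (hh : ContDiffOn ℝ (⊤ : ℕ∞) h Ω) (hg : ContDiffOn ℝ (⊤ : ℕ∞) g Ω)
    (hx : x ∈ Ω) (e : Fin 2 → ℝ) :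
    dd e (fun y => h y - g y) x = dd e h x - dd e g x :=
  dd_eq_of_hasDerivAt (differentiableAt_of_contDiffOn hΩ (hh.sub hg) hx)
    ((hasDerivAt_line_zero hΩ hh e hx).sub (hasDerivAt_line_zero hΩ hg e hx))

lemma dd_const_mul (hΩ : IsOpen Ω) (hh : ContDiffOn ℝ (⊤ : ℕ∞) h Ω) (k : ℝ)
    (hx : x ∈ Ω) (e : Fin 2 → ℝ) :
    dd e (fun y => k * h y) x = k * dd e h x :=
  dd_eq_of_hasDerivAt (differentiableAt_of_contDiffOn hΩ (contDiffOn_const.mul hh) hx)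
    ((hasDerivAt_line_zero hΩ hh e hx).const_mul k)

lemma dd_exp (hΩ : IsOpen Ω) (hh : ContDiffOn ℝ (⊤ : ℕ∞) h Ω)
    (hx : x ∈ Ω) (e : Fin 2 → ℝ) :
    dd e (fun y => Real.exp (h y)) x = Real.exp (h x) * dd e h x := by
  refine dd_eq_of_hasDerivAt (differentiableAt_of_contDiffOn hΩ hh.exp hx) ?_
  simpa using (hasDerivAt_line_zero hΩ hh e hx).exp

/-- The standard basis vectors of the plane. -/
noncomputable def std (i : Fin 2) : Fin 2 → ℝ := Pi.single i 1

lemma pd_eq_dd_std (i : Fin 2) (h : (Fin 2 → ℝ) → ℝ) : pd i h = dd (std i) h := rfl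

/-- The logarithm of `ρ`, as a multiple of the logarithm of the Hessian determinant. -/
noncomputable def logRho (f : (Fin 2 → ℝ) → ℝ) (x : Fin 2 → ℝ) : ℝ :=
  -(1 / 4) * Real.log (frameD (std 0) (std 1) f x)

/-- `f` is smooth with positive definite Hessian on the open set `Ω`. -/
structure IsStrict (Ω : Set (Fin 2 → ℝ)) (f : (Fin 2 → ℝ) → ℝ) : Prop where
  isOpen : IsOpen Ω
  smooth : ContDiffOn ℝ (⊤ : ℕ∞) f Ω
  posDef : ∀ x ∈ Ω, (hess f x).PosDef

lemma frameD_smooth (hΩ : IsOpen Ω) (hf : ContDiffOn ℝ (⊤ : ℕ∞) f Ω) (e₁ e₂ : Fin 2 → ℝ) :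
    ContDiffOn ℝ (⊤ : ℕ∞) (frameD e₁ e₂ f) Ω := by
  have f1 := contDiffOn_dd hΩ hf e₁
  have f2 := contDiffOn_dd hΩ hf e₂
  have f11 := contDiffOn_dd hΩ f1 e₁
  have f12 := contDiffOn_dd hΩ f2 e₁
  have f22 := contDiffOn_dd hΩ f2 e₂
  exact (f11.mul f22).sub (f12.mul f12)

lemma frameN_smooth (hΩ : IsOpen Ω) (hf : ContDiffOn ℝ (⊤ : ℕ∞) f Ω)
    (hh : ContDiffOn ℝ (⊤ : ℕ∞) h Ω) (e₁ e₂ : Fin 2 → ℝ) :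
    ContDiffOn ℝ (⊤ : ℕ∞) (frameN e₁ e₂ f h) Ω := by
  have f1 := contDiffOn_dd hΩ hf e₁
  have f2 := contDiffOn_dd hΩ hf e₂
  have f11 := contDiffOn_dd hΩ f1 e₁
  have f12 := contDiffOn_dd hΩ f2 e₁
  have f22 := contDiffOn_dd hΩ f2 e₂
  have h1 := contDiffOn_dd hΩ hh e₁
  have h2 := contDiffOn_dd hΩ hh e₂
  exact ((f22.mul (h1.mul h1)).sub (contDiffOn_const.mul (f12.mul (h1.mul h2)))).add
    (f11.mul (h2.mul h2))

lemma dd_frameD (hΩ : IsOpen Ω) (hf : ContDiffOn ℝ (⊤ : ℕ∞) f Ω) (e₁ e₂ e : Fin 2 → ℝ)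
    (hx : x ∈ Ω) : dd e (frameD e₁ e₂ f) x = frameD' e e₁ e₂ f x := by
  have f1 := contDiffOn_dd hΩ hf e₁
  have f2 := contDiffOn_dd hΩ hf e₂
  have f11 := contDiffOn_dd hΩ f1 e₁
  have f12 := contDiffOn_dd hΩ f2 e₁
  have f22 := contDiffOn_dd hΩ f2 e₂
  have := dd_sub hΩ (f11.mul f22) (f12.mul f12) hx e
  refine this.trans ?_
  rw [dd_mul hΩ f11 f22 hx, dd_mul hΩ f12 f12 hx, frameD']
  ring

section Frames

/-- The square of the determinant of the frame `e₁`, `e₂`. -/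
noncomputable def frameK (e₁ e₂ : Fin 2 → ℝ) : ℝ := (e₁ 0 * e₂ 1 - e₁ 1 * e₂ 0) ^ 2

lemma frameD_eq (hΩ : IsOpen Ω) (hf : ContDiffOn ℝ (⊤ : ℕ∞) f Ω) (e₁ e₂ : Fin 2 → ℝ) :
    ∀ y ∈ Ω, frameD e₁ e₂ f y = frameK e₁ e₂ * frameD (std 0) (std 1) f y := fun y hy => by
  simp only [frameD, frameK, dd_dd_eq_pd hΩ hf e₁ e₁ y hy, dd_dd_eq_pd hΩ hf e₁ e₂ y hy,
    dd_dd_eq_pd hΩ hf e₂ e₂ y hy, ← pd_eq_dd_std]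
  ring

lemma frameN_eq (hΩ : IsOpen Ω) (hf : ContDiffOn ℝ (⊤ : ℕ∞) f Ω) (h : (Fin 2 → ℝ) → ℝ)
    (e₁ e₂ : Fin 2 → ℝ) :
    ∀ y ∈ Ω, frameN e₁ e₂ f h y = frameK e₁ e₂ * frameN (std 0) (std 1) f h y := fun y hy => by
  simp only [frameN, frameK, dd_dd_eq_pd hΩ hf e₁ e₁ y hy, dd_dd_eq_pd hΩ hf e₁ e₂ y hy,
    dd_dd_eq_pd hΩ hf e₂ e₂ y hy, ← pd_eq_dd_std, dd_eq_pd e₁ h, dd_eq_pd e₂ h]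
  ring

lemma frameL_eq (hΩ : IsOpen Ω) (hf : ContDiffOn ℝ (⊤ : ℕ∞) f Ω)
    (hh : ContDiffOn ℝ (⊤ : ℕ∞) h Ω) (e₁ e₂ : Fin 2 → ℝ) :
    ∀ y ∈ Ω, frameL e₁ e₂ f h y = frameK e₁ e₂ * frameL (std 0) (std 1) f h y := fun y hy => by
  simp only [frameL, frameK, dd_dd_eq_pd hΩ hf e₁ e₁ y hy, dd_dd_eq_pd hΩ hf e₁ e₂ y hy,
    dd_dd_eq_pd hΩ hf e₂ e₂ y hy, ← pd_eq_dd_std, dd_dd_eq_pd hΩ hh e₁ e₁ y hy,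
    dd_dd_eq_pd hΩ hh e₁ e₂ y hy, dd_dd_eq_pd hΩ hh e₂ e₂ y hy]
  ring

end Frames

namespace IsStrict

lemma pd_comm (hs : IsStrict Ω f) (hx : x ∈ Ω) : pd 1 (pd 0 f) x = pd 0 (pd 1 f) x :=
  dd_comm hs.isOpen hs.smooth _ _ x hx

lemma det_hess (hs : IsStrict Ω f) (hx : x ∈ Ω) :
    (hess f x).det = frameD (std 0) (std 1) f x := by
  rw [Matrix.det_fin_two]
  simp only [hess, Matrix.of_apply, hs.pd_comm hx, frameD, ← pd_eq_dd_std]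

lemma frameD_pos (hs : IsStrict Ω f) (hx : x ∈ Ω) : 0 < frameD (std 0) (std 1) f x := by
  rw [← hs.det_hess hx]; exact (hs.posDef x hx).det_pos

lemma frameN_nonneg (hs : IsStrict Ω f) (hx : x ∈ Ω) (h : (Fin 2 → ℝ) → ℝ) :
    0 ≤ frameN (std 0) (std 1) f h x := by
  have := (hs.posDef x hx).posSemidef.dotProduct_mulVec_nonneg ![-pd 1 h x, pd 0 h x]
  simp [Matrix.mulVec, dotProduct, Fin.sum_univ_two, hess, hs.pd_comm hx] at this
  simp only [frameN, ← pd_eq_dd_std]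
  linarith

lemma logRho_smooth (hs : IsStrict Ω f) : ContDiffOn ℝ (⊤ : ℕ∞) (logRho f) Ω :=
  contDiffOn_const.mul ((frameD_smooth hs.isOpen hs.smooth _ _).log
    fun _ hy => (hs.frameD_pos hy).ne')

lemma frameD_eq_exp (hs : IsStrict Ω f) (hx : x ∈ Ω) :
    frameD (std 0) (std 1) f x = Real.exp (-4 * logRho f x) := by
  have : -4 * logRho f x = Real.log (frameD (std 0) (std 1) f x) := by rw [logRho]; ring
  rw [this, Real.exp_log (hs.frameD_pos hx)]

lemma rho_eq_exp (hs : IsStrict Ω f) (hx : x ∈ Ω) : rho f x = Real.exp (logRho f x) := by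
  rw [rho, hs.det_hess hx, Real.rpow_def_of_pos (hs.frameD_pos hx), logRho]
  congr 1
  push_cast
  ring

lemma dd_logRho (hs : IsStrict Ω f) (e₁ e₂ e : Fin 2 → ℝ) (hx : x ∈ Ω) :
    -4 * (dd e (logRho f) x * frameD e₁ e₂ f x) = frameD' e e₁ e₂ f x := by
  rw [← dd_frameD hs.isOpen hs.smooth e₁ e₂ e hx,
    dd_congr hs.isOpen (frameD_eq hs.isOpen hs.smooth e₁ e₂) e x hx,
    dd_const_mul hs.isOpen (frameD_smooth hs.isOpen hs.smooth _ _) _ hx,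
    dd_congr hs.isOpen (fun y hy => hs.frameD_eq_exp hy) e x hx,
    dd_exp hs.isOpen (contDiffOn_const.mul hs.logRho_smooth) hx,
    dd_const_mul hs.isOpen hs.logRho_smooth _ hx,
    frameD_eq hs.isOpen hs.smooth e₁ e₂ x hx, hs.frameD_eq_exp hx]
  ring

lemma pd_rho (hs : IsStrict Ω f) (hx : x ∈ Ω) (i : Fin 2) :
    pd i (rho f) x = Real.exp (logRho f x) * pd i (logRho f) x :=
  (dd_congr hs.isOpen (fun _ hy => hs.rho_eq_exp hy) _ x hx).trans
    (dd_exp hs.isOpen hs.logRho_smooth hx _)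

lemma inv_hess (hs : IsStrict Ω f) (hx : x ∈ Ω) :
    (hess f x)⁻¹ = Real.exp (4 * logRho f x) •
      !![pd 1 (pd 1 f) x, -pd 0 (pd 1 f) x; -pd 0 (pd 1 f) x, pd 0 (pd 0 f) x] := by
  rw [Matrix.inv_def, hs.det_hess hx, hs.frameD_eq_exp hx, Matrix.adjugate_fin_two,
    Ring.inverse_eq_inv', ← Real.exp_neg]
  simp only [hess, Matrix.of_apply, hs.pd_comm hx]
  congr 2
  ring

lemma gradSq_eq (hs : IsStrict Ω f) (hx : x ∈ Ω) (h : (Fin 2 → ℝ) → ℝ) :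
    gradSq f h x = frameN (std 0) (std 1) f h x * Real.exp (4 * logRho f x) := by
  rw [gradSq, hs.inv_hess hx]
  simp [Fin.sum_univ_two, frameN, ← pd_eq_dd_std]
  ring

lemma Phi_eq (hs : IsStrict Ω f) (hx : x ∈ Ω) :
    Phi f x = frameN (std 0) (std 1) f (logRho f) x * Real.exp (4 * logRho f x) := by
  rw [Phi, hs.gradSq_eq hx, hs.rho_eq_exp hx]
  simp only [frameN, ← pd_eq_dd_std, hs.pd_rho hx]
  have := (Real.exp_pos (logRho f x)).ne'
  field_simp

lemma pde (hs : IsStrict Ω f) (hP : PDE2 f 0 Ω) (hx : x ∈ Ω) :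
    frameL (std 0) (std 1) f (logRho f) x + 3 * frameN (std 0) (std 1) f (logRho f) x = 0 := by
  have h0 := hP x hx
  have hsq : ∀ y ∈ Ω, Real.sqrt (hess f y).det = Real.exp (-2 * logRho f y) := fun y hy => by
    rw [hs.det_hess hy, hs.frameD_eq_exp hy, Real.sqrt_eq_iff_mul_self_eq (by positivity)
      (by positivity), ← Real.exp_add]
    congr 1; ring
  rw [calabiLap, neg_zero, zero_mul, zero_div, hsq x hx, ← Real.exp_neg] at h0
  have h1 := (mul_eq_zero.1 h0).resolve_left (Real.exp_pos _).ne'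
  simp only [Fin.sum_univ_two] at h1
  set u := logRho f with hu
  have hus := hs.logRho_smooth
  have key : ∀ (i j : Fin 2) (F : (Fin 2 → ℝ) → ℝ), ContDiffOn ℝ (⊤ : ℕ∞) F Ω →
      (∀ y ∈ Ω, (hess f y)⁻¹ i j = Real.exp (4 * u y) * F y) →
      pd i (fun y => Real.sqrt (hess f y).det * (hess f y)⁻¹ i j * pd j (rho f) y) x =
        Real.exp (3 * u x) * (3 * pd i u x * (F x * pd j u x) + pd i F x * pd j u x
          + F x * pd i (pd j u) x) := by
    intro i j F hF hFe
    have e1 : ∀ y ∈ Ω, Real.sqrt (hess f y).det * (hess f y)⁻¹ i j * pd j (rho f) y =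
        Real.exp (3 * u y) * (F y * pd j u y) := fun y hy => by
      rw [hsq y hy, hFe y hy, hs.pd_rho hy, ← hu]
      have : Real.exp (3 * u y) = Real.exp (-2 * u y) * Real.exp (4 * u y) * Real.exp (u y) := by
        rw [← Real.exp_add, ← Real.exp_add]; congr 1; ring
      rw [this]; ring
    have huj : ContDiffOn ℝ (⊤ : ℕ∞) (pd j u) Ω := contDiffOn_dd hs.isOpen hus _
    have h3 : ContDiffOn ℝ (⊤ : ℕ∞) (fun y => 3 * u y) Ω := contDiffOn_const.mul hus
    rw [pd_eq_dd_std, dd_congr hs.isOpen e1 _ x hx,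
      dd_mul hs.isOpen h3.exp (hF.mul huj) hx, dd_exp hs.isOpen h3 hx,
      dd_const_mul hs.isOpen hus 3 hx, dd_mul hs.isOpen hF huj hx]
    simp only [← pd_eq_dd_std]
    ring
  have hpd : ∀ i j, ContDiffOn ℝ (⊤ : ℕ∞) (pd i (pd j f)) Ω := fun i j =>
    contDiffOn_dd hs.isOpen (contDiffOn_dd hs.isOpen hs.smooth _) _
  have hneg : ContDiffOn ℝ (⊤ : ℕ∞) (fun y => (-1) * pd 0 (pd 1 f) y) Ω :=
    contDiffOn_const.mul (hpd 0 1)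
  have hn : ∀ i, pd i (fun y => (-1) * pd 0 (pd 1 f) y) x = -1 * pd i (pd 0 (pd 1 f)) x :=
    fun i => dd_const_mul hs.isOpen (hpd 0 1) _ hx _
  rw [key 0 0 _ (hpd 1 1) (fun y hy => by rw [hs.inv_hess hy]; simp [hu]),
    key 0 1 _ hneg (fun y hy => by rw [hs.inv_hess hy]; simp [hu]),
    key 1 0 _ hneg (fun y hy => by rw [hs.inv_hess hy]; simp [hu]),
    key 1 1 _ (hpd 0 0) (fun y hy => by rw [hs.inv_hess hy]; simp [hu]), hn, hn] at h1
  have s1 : pd 1 (pd 0 (pd 1 f)) x = pd 0 (pd 1 (pd 1 f)) x :=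
    dd_comm hs.isOpen (contDiffOn_dd hs.isOpen hs.smooth _) _ _ x hx
  have s2 : pd 1 (pd 0 (pd 0 f)) x = pd 0 (pd 0 (pd 1 f)) x :=
    (dd_comm hs.isOpen (contDiffOn_dd hs.isOpen hs.smooth _) _ _ x hx).trans
      (dd_congr hs.isOpen (fun y hy => hs.pd_comm hy) _ x hx)
  have s3 : pd 1 (pd 0 u) x = pd 0 (pd 1 u) x := dd_comm hs.isOpen hus _ _ x hx
  rw [s1, s2, s3] at h1
  have hE := (Real.exp_pos (3 * u x)).ne'
  apply mul_left_cancel₀ hE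
  simp only [frameL, frameN, ← pd_eq_dd_std]
  linear_combination h1

lemma pde_frame (hs : IsStrict Ω f) (hP : PDE2 f 0 Ω) (e₁ e₂ : Fin 2 → ℝ) :
    ∀ y ∈ Ω, frameL e₁ e₂ f (logRho f) y + 3 * frameN e₁ e₂ f (logRho f) y = 0 := fun y hy => by
  rw [frameL_eq hs.isOpen hs.smooth hs.logRho_smooth e₁ e₂ y hy,
    frameN_eq hs.isOpen hs.smooth (logRho f) e₁ e₂ y hy]
  linear_combination frameK e₁ e₂ * hs.pde hP hy

/-- An orthonormal frame at `x` whose first vector is dual to the differential of `h`. -/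
lemma exists_frame (hs : IsStrict Ω f) (hP : PDE2 f 0 Ω) (hx : x ∈ Ω)
    (h : (Fin 2 → ℝ) → ℝ) (hh : 0 < frameN (std 0) (std 1) f h x) :
    ∃ (e₁ e₂ : Fin 2 → ℝ) (c : FrameCoeffs), IsFrame c e₁ e₂ f (logRho f) x ∧
      c.p1 = dd e₁ (logRho f) x ∧ c.p2 = dd e₂ (logRho f) x ∧
      c.q1 = dd e₁ f x ∧ c.q2 = dd e₂ f x ∧ 0 < dd e₁ h x ∧ dd e₂ h x = 0 ∧
      frameK e₁ e₂ = Real.exp (4 * logRho f x) ∧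
      ∀ g, frameK e₁ e₂ * frameN (std 0) (std 1) f g x = dd e₁ g x ^ 2 + dd e₂ g x ^ 2 := by
  have hD := hs.frameD_pos hx
  simp only [frameN, frameD, ← pd_eq_dd_std] at hh hD
  set a := pd 0 (pd 0 f) x with ha
  set b := pd 0 (pd 1 f) x with hb
  set d := pd 1 (pd 1 f) x with hd
  set v := pd 0 h x with hv
  set w := pd 1 h x with hw
  set n := d * (v * v) - 2 * (b * (v * w)) + a * (w * w) with hn
  set D := a * d - b * b with hDd
  obtain ⟨s, hs0, hs2⟩ : ∃ s : ℝ, 0 < s ∧ s ^ 2 = n := ⟨√n, Real.sqrt_pos.2 hh, Real.sq_sqrt hh.le⟩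
  obtain ⟨r, hr0, hr2⟩ : ∃ r : ℝ, 0 < r ∧ r ^ 2 = D := ⟨√D, Real.sqrt_pos.2 hD, Real.sq_sqrt hD.le⟩
  set e₁ : Fin 2 → ℝ := ![(d * v - b * w) / (r * s), (a * w - b * v) / (r * s)] with he₁
  set e₂ : Fin 2 → ℝ := ![-w / s, v / s] with he₂
  have h11 : dd e₁ (dd e₁ f) x = 1 := by
    rw [dd_dd_eq_pd hs.isOpen hs.smooth _ _ x hx, ← ha, ← hb, ← hd]
    simp only [he₁, Matrix.cons_val_zero, Matrix.cons_val_one]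
    field_simp
    rw [hs2, hr2, hn, hDd]; ring
  have h12 : dd e₁ (dd e₂ f) x = 0 := by
    rw [dd_dd_eq_pd hs.isOpen hs.smooth _ _ x hx, ← ha, ← hb, ← hd]
    simp only [he₁, he₂, Matrix.cons_val_zero, Matrix.cons_val_one]
    field_simp
    ring
  have h22 : dd e₂ (dd e₂ f) x = 1 := by
    rw [dd_dd_eq_pd hs.isOpen hs.smooth _ _ x hx, ← ha, ← hb, ← hd]
    simp only [he₂, Matrix.cons_val_zero, Matrix.cons_val_one]
    field_simp
    rw [hs2, hn]; ring
  obtain ⟨c, hc, c1, c2, c3, c4⟩ := exists_isFrame hs.isOpen hs.smooth hs.logRho_smooth hx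
    (fun y hy => hs.dd_logRho e₁ e₂ e₁ hy) (fun y hy => hs.dd_logRho e₁ e₂ e₂ hy)
    (hs.pde_frame hP e₁ e₂) h11 h12 h22
  refine ⟨e₁, e₂, c, hc, c1, c2, c3, c4, ?_, ?_, ?_, ?_⟩
  · rw [dd_eq_pd, ← hv, ← hw]
    simp only [he₁, Matrix.cons_val_zero, Matrix.cons_val_one]
    have : (d * v - b * w) / (r * s) * v + (a * w - b * v) / (r * s) * w = n / (r * s) := by
      rw [hn]; ring
    rw [this]; positivity
  · rw [dd_eq_pd, ← hv, ← hw]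
    simp only [he₂, Matrix.cons_val_zero, Matrix.cons_val_one]
    ring
  · have h1 := frameD_eq hs.isOpen hs.smooth e₁ e₂ x hx
    rw [hs.frameD_eq_exp hx, frameD, h11, h12, h22] at h1
    have h2 : Real.exp (4 * logRho f x) * Real.exp (-4 * logRho f x) = 1 := by
      rw [← Real.exp_add]; simp
    apply mul_right_cancel₀ (Real.exp_pos (-4 * logRho f x)).ne'
    rw [h2, ← h1]; ring
  · intro g
    rw [← frameN_eq hs.isOpen hs.smooth g e₁ e₂ x hx, frameN, h11, h12, h22]; ring

end IsStrict

end Coordinates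

section Global

variable {Ω : Set (Fin 2 → ℝ)} {f : (Fin 2 → ℝ) → ℝ} {x : Fin 2 → ℝ} {n : ℕ} {C b : ℝ}

/-- The weight `ρ^{-(n + 2)}`, written as an exponential. -/
noncomputable def weight (n : ℕ) (f : (Fin 2 → ℝ) → ℝ) (y : Fin 2 → ℝ) : ℝ :=
  Real.exp (-((n : ℝ) + 2) * logRho f y)

lemma weight_pos (n : ℕ) (f : (Fin 2 → ℝ) → ℝ) (y : Fin 2 → ℝ) : 0 < weight n f y :=
  Real.exp_pos _

namespace IsStrict

lemma Phi_nonneg (hs : IsStrict Ω f) (hx : x ∈ Ω) : 0 ≤ Phi f x := by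
  rw [hs.Phi_eq hx]; exact mul_nonneg (hs.frameN_nonneg hx _) (Real.exp_pos _).le

lemma gradSq_nonneg (hs : IsStrict Ω f) (hx : x ∈ Ω) : 0 ≤ gradSq f f x := by
  rw [hs.gradSq_eq hx]; exact mul_nonneg (hs.frameN_nonneg hx _) (Real.exp_pos _).le

lemma weight_le (hs : IsStrict Ω f) (hb : ∀ y ∈ Ω, 1 / rho f y ≤ b) (hx : x ∈ Ω) :
    weight n f x ≤ b ^ (n + 2) := by
  have h1 := hb x hx
  rw [hs.rho_eq_exp hx, one_div, ← Real.exp_neg] at h1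
  have h2 : weight n f x = Real.exp (-logRho f x) ^ (n + 2) := by
    rw [weight, ← Real.exp_nat_mul]; congr 1; push_cast; ring
  rw [h2]
  exact pow_le_pow_left₀ (Real.exp_pos _).le h1 _

lemma rho_rpow (hs : IsStrict Ω f) (hx : x ∈ Ω) (a : ℝ) :
    a / rho f x ^ ((n : ℝ) + 2) = a * weight n f x := by
  rw [hs.rho_eq_exp hx, ← Real.exp_mul, weight, div_eq_mul_inv, ← Real.exp_neg]
  congr 2; ring

lemma continuousOn_weight (hs : IsStrict Ω f) : ContinuousOn (weight n f) Ω :=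
  (contDiffOn_const.mul hs.logRho_smooth).exp.continuousOn

lemma smooth_gradSq (hs : IsStrict Ω f) : ContDiffOn ℝ (⊤ : ℕ∞) (gradSq f f) Ω :=
  ((frameN_smooth hs.isOpen hs.smooth hs.smooth _ _).mul
    (contDiffOn_const.mul hs.logRho_smooth).exp).congr fun _ hy => hs.gradSq_eq hy _

lemma smooth_Phi (hs : IsStrict Ω f) : ContDiffOn ℝ (⊤ : ℕ∞) (Phi f) Ω :=
  ((frameN_smooth hs.isOpen hs.smooth hs.logRho_smooth _ _).mul
    (contDiffOn_const.mul hs.logRho_smooth).exp).congr fun _ hy => hs.Phi_eq hy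

/-- Rewriting `k ψ e^{4u} ρ^{-(n+2)} d^m` as an exponential of a sum of logarithms. -/
lemma exp_log_weight (n m : ℕ) {k N d : ℝ} (hk : 0 < k) (hN : 0 < N) (hd : 0 < d)
    (y : Fin 2 → ℝ) :
    Real.exp (Real.log (k * N) + (4 - ((n : ℝ) + 2)) * logRho f y + m * Real.log d) =
      k * ((N * Real.exp (4 * logRho f y)) * (weight n f y * d ^ m)) := by
  rw [Real.exp_add, Real.exp_add, Real.exp_log (by positivity), weight,
    Real.exp_nat_mul, Real.exp_log hd]
  have : Real.exp ((4 - ((n : ℝ) + 2)) * logRho f y) =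
      Real.exp (4 * logRho f y) * Real.exp (-((n : ℝ) + 2) * logRho f y) := by
    rw [← Real.exp_add]; congr 1; ring
  rw [this]; ring

lemma Phi_le_of_isLocalMax (hs : IsStrict Ω f) (hP : PDE2 f 0 Ω) (hx : x ∈ Ω)
    (hδ : f x < C) (hΦ : 0 < Phi f x)
    (hm : IsLocalMax (fun y => Phi f y * (weight n f y * (C - f y) ^ (n + 2))) x) :
    Phi f x ≤ 4 / (C - f x) + 6 * (gradSq f f x / (C - f x) ^ 2) := by
  have hΦ' := hΦ
  rw [hs.Phi_eq hx] at hΦ'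
  have hN : 0 < frameN (std 0) (std 1) f (logRho f) x :=
    (mul_pos_iff_of_pos_right (Real.exp_pos _)).1 hΦ'
  obtain ⟨e₁, e₂, c, hc, c1, c2, c3, c4, d1, d2, hK, hq⟩ := hs.exists_frame hP hx (logRho f) hN
  have hK0 : 0 < frameK e₁ e₂ := by rw [hK]; exact Real.exp_pos _
  have ev : ∀ᶠ y in 𝓝 x, Real.exp (Real.log (frameN e₁ e₂ f (logRho f) y)
      + (4 - ((n : ℝ) + 2)) * logRho f y + ((n : ℝ) + 2) * Real.log (C - f y)) =
      frameK e₁ e₂ * (Phi f y * (weight n f y * (C - f y) ^ (n + 2))) := by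
    have h1 := hs.isOpen.mem_nhds hx
    have h2 : ∀ᶠ y in 𝓝 x, 0 < frameN (std 0) (std 1) f (logRho f) y :=
      ((frameN_smooth hs.isOpen hs.smooth hs.logRho_smooth _ _).continuousOn.continuousAt
        h1).eventually (lt_mem_nhds hN)
    have h3 : ∀ᶠ y in 𝓝 x, f y < C :=
      (hs.smooth.continuousOn.continuousAt h1).eventually (gt_mem_nhds hδ)
    filter_upwards [h1, h2, h3] with y hy hy2 hy3
    have := exp_log_weight (f := f) n (n + 2) hK0 hy2 (sub_pos.2 hy3) y
    push_cast at this
    rw [frameN_eq hs.isOpen hs.smooth (logRho f) e₁ e₂ y hy, this, hs.Phi_eq hy]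
  have hm' : IsLocalMax (fun y => Real.log (frameN e₁ e₂ f (logRho f) y)
      + (4 - ((n : ℝ) + 2)) * logRho f y + ((n : ℝ) + 2) * Real.log (C - f y)) x := by
    filter_upwards [ev, hm] with y hy1 hy2
    rw [← Real.exp_le_exp, hy1, ev.self_of_nhds]
    exact mul_le_mul_of_nonneg_left hy2 hK0.le
  have := hc.Phi_bound (by rw [c1]; exact d1.ne') (by rw [c2, d2]) (by positivity) rfl
    (sub_pos.2 hδ) hm'
  have k1 := hq (logRho f)
  have k2 := hq f
  rw [d2] at k1
  rw [hs.Phi_eq hx, hs.gradSq_eq hx, ← hK, mul_comm _ (frameK e₁ e₂), k1,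
    mul_comm _ (frameK e₁ e₂), k2, ← c1, ← c3, ← c4]
  calc _ = c.p1 ^ 2 := by ring
    _ ≤ _ := this
    _ = _ := by rw [add_div, div_pow, div_pow]

lemma gradSq_le_of_isLocalMax (hs : IsStrict Ω f) (hP : PDE2 f 0 Ω) (hx : x ∈ Ω)
    (hn : (10 : ℝ) ^ 7 ≤ n) (hδ : f x < C) (hQ : 0 < gradSq f f x) {l : ℝ} (hl : 0 < l)
    (hH : l * (Phi f x * (weight n f x * (C - f x) ^ (n + 2))) ≤ 1 / 1000)
    (hB : 1 ≤ 8000 * (l * (gradSq f f x * (weight n f x * (C - f x) ^ n))))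
    (hm : IsLocalMax (fun y => gradSq f f y * (weight n f y * (C - f y) ^ n) *
      Real.exp (l * (Phi f y * (weight n f y * (C - f y) ^ (n + 2))))) x) :
    gradSq f f x ≤ 3 * (C - f x) := by
  have hQ' := hQ
  rw [hs.gradSq_eq hx] at hQ'
  have hN : 0 < frameN (std 0) (std 1) f f x :=
    (mul_pos_iff_of_pos_right (Real.exp_pos _)).1 hQ'
  obtain ⟨e₁, e₂, c, hc, c1, c2, c3, c4, d1, d2, hK, hq⟩ := hs.exists_frame hP hx f hN
  have hK0 : 0 < frameK e₁ e₂ := by rw [hK]; exact Real.exp_pos _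
  have hpow : ∀ (d : ℝ), 0 < d → ∀ y,
      Real.exp ((4 - ((n : ℝ) + 2)) * logRho f y + ((n : ℝ) + 2) * Real.log d) =
      Real.exp (4 * logRho f y) * (weight n f y * d ^ (n + 2)) := fun d hd y => by
    have := exp_log_weight (f := f) n (n + 2) one_pos one_pos hd y
    push_cast at this
    simpa using this
  have ev : ∀ᶠ y in 𝓝 x, Real.exp (Real.log (frameN e₁ e₂ f f y)
      + (4 - ((n : ℝ) + 2)) * logRho f y + ((n : ℝ) + 2 - 2) * Real.log (C - f y)
      + l / frameK e₁ e₂ * (frameN e₁ e₂ f (logRho f) y * Real.exp ((4 - ((n : ℝ) + 2)) * logRho f y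
        + ((n : ℝ) + 2) * Real.log (C - f y)))) =
      frameK e₁ e₂ * (gradSq f f y * (weight n f y * (C - f y) ^ n) *
      Real.exp (l * (Phi f y * (weight n f y * (C - f y) ^ (n + 2))))) := by
    have h1 := hs.isOpen.mem_nhds hx
    have h2 : ∀ᶠ y in 𝓝 x, 0 < frameN (std 0) (std 1) f f y :=
      ((frameN_smooth hs.isOpen hs.smooth hs.smooth _ _).continuousOn.continuousAt
        h1).eventually (lt_mem_nhds hN)
    have h3 : ∀ᶠ y in 𝓝 x, f y < C :=
      (hs.smooth.continuousOn.continuousAt h1).eventually (gt_mem_nhds hδ)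
    filter_upwards [h1, h2, h3] with y hy hy2 hy3
    have h4 := exp_log_weight (f := f) n n hK0 hy2 (sub_pos.2 hy3) y
    rw [hpow _ (sub_pos.2 hy3), Real.exp_add, add_sub_cancel_right,
      frameN_eq hs.isOpen hs.smooth f e₁ e₂ y hy,
      frameN_eq hs.isOpen hs.smooth (logRho f) e₁ e₂ y hy, h4, hs.Phi_eq hy, hs.gradSq_eq hy]
    have h5 : l / frameK e₁ e₂ * (frameK e₁ e₂ * frameN (std 0) (std 1) f (logRho f) y *
        (Real.exp (4 * logRho f y) * (weight n f y * (C - f y) ^ (n + 2)))) =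
        l * (frameN (std 0) (std 1) f (logRho f) y * Real.exp (4 * logRho f y) *
          (weight n f y * (C - f y) ^ (n + 2))) := by field_simp
    rw [h5]; ring
  have hm' : IsLocalMax (fun y => Real.log (frameN e₁ e₂ f f y)
      + (4 - ((n : ℝ) + 2)) * logRho f y + ((n : ℝ) + 2 - 2) * Real.log (C - f y)
      + l / frameK e₁ e₂ * (frameN e₁ e₂ f (logRho f) y * Real.exp ((4 - ((n : ℝ) + 2)) * logRho f y
        + ((n : ℝ) + 2) * Real.log (C - f y)))) x := by
    filter_upwards [ev, hm] with y hy1 hy2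
    rw [← Real.exp_le_exp, hy1, ev.self_of_nhds]
    exact mul_le_mul_of_nonneg_left hy2 hK0.le
  have hδ0 := sub_pos.2 hδ
  have k1 := hq (logRho f)
  have k2 := hq f
  rw [d2] at k2
  have hΦe : Phi f x = c.p1 ^ 2 + c.p2 ^ 2 := by
    rw [hs.Phi_eq hx, ← hK, mul_comm, k1, c1, c2]
  have hQe : gradSq f f x = c.q1 ^ 2 := by
    rw [hs.gradSq_eq hx, ← hK, mul_comm, k2, c3]; ring
  have hw : l / frameK e₁ e₂ * Real.exp ((4 - ((n : ℝ) + 2)) * logRho f x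
      + ((n : ℝ) + 2) * Real.log (C - f x)) = l * (weight n f x * (C - f x) ^ (n + 2)) := by
    rw [hpow _ hδ0, ← hK]; field_simp
  rw [hQe]
  refine hc.grad_bound (by rw [c3]; exact d1) (by rw [c4, d2]) (by linarith) rfl hδ0
    (div_pos hl hK0) hw.symm ?_ ?_ hm'
  · rw [← hΦe]
    calc _ = _ := by ring
      _ ≤ _ := hH
  · rw [hQe] at hB
    refine hB.trans_eq ?_
    rw [pow_add]
    field_simp

end IsStrict

end Global

section Estimate

variable {Ω : Set (Fin 2 → ℝ)} {f : (Fin 2 → ℝ) → ℝ} {C C' b : ℝ} {n : ℕ}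

lemma isBounded_ebal : Bornology.IsBounded (ebal 1) := by
  refine (Metric.isBounded_closedBall (x := (0 : Fin 2 → ℝ)) (r := 1)).subset fun x hx => ?_
  change x 0 ^ 2 + x 1 ^ 2 < 1 ^ 2 at hx
  rw [mem_closedBall_zero_iff, pi_norm_le_iff_of_nonneg zero_le_one]
  intro i
  rw [Real.norm_eq_abs, abs_le_one_iff_mul_self_le_one]
  fin_cases i <;> simp <;> nlinarith [sq_nonneg (x 0), sq_nonneg (x 1)]

lemma isCompact_closure_of_normalized (hΩ : NormalizedDomain Ω) : IsCompact (closure Ω) :=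
  (isBounded_ebal.subset hΩ.2.2.2).isCompact_closure

lemma nonneg_of_sClass (hΩ : NormalizedDomain Ω) (hf : SClass Ω C f) {x : Fin 2 → ℝ}
    (hx : x ∈ Ω) : 0 ≤ f x := by
  rw [← hf.2.2.1]
  refine csInf_le ?_ (Set.mem_image_of_mem f hx)
  exact ((isCompact_closure_of_normalized hΩ).image_of_continuousOn hf.2.2.2.1).bddBelow.mono
    (Set.image_mono subset_closure)

/-- The sublevel set `{f ≤ C'}`, for `C' < C`, is a compact subset of the domain. -/
lemma isCompact_sublevel (hΩ : NormalizedDomain Ω) (hf : SClass Ω C f) (hC : C' < C) :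
    IsCompact {x | x ∈ Ω ∧ f x ≤ C'} := by
  have h1 : {x | x ∈ Ω ∧ f x ≤ C'} = closure Ω ∩ f ⁻¹' Set.Iic C' := by
    ext x
    refine ⟨fun h => ⟨subset_closure h.1, h.2⟩, fun h => ⟨?_, h.2⟩⟩
    by_contra hx
    have h2 : x ∈ frontier Ω := by rw [hΩ.1.frontier_eq]; exact ⟨h.1, hx⟩
    have h3 := hf.2.2.2.2 x h2
    have h4 : f x ≤ C' := h.2
    linarith
  rw [h1]
  exact (isCompact_closure_of_normalized hΩ).of_isClosed_subset
    (hf.2.2.2.1.preimage_isClosed_of_isClosed isClosed_closure isClosed_Iic) Set.inter_subset_left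

lemma isLocalMax_of_isMaxOn_sublevel (hs : IsStrict Ω f) {g : (Fin 2 → ℝ) → ℝ}
    {x : Fin 2 → ℝ} (hx : x ∈ Ω) (hfx : f x < C')
    (hm : IsMaxOn g {x | x ∈ Ω ∧ f x ≤ C'} x) : IsLocalMax g x := by
  have h1 := hs.isOpen.mem_nhds hx
  have h3 : ∀ᶠ y in 𝓝 x, f y < C' :=
    (hs.smooth.continuousOn.continuousAt h1).eventually (gt_mem_nhds hfx)
  filter_upwards [h1, h3] with y hy hy2 using hm ⟨hy, hy2.le⟩

/-- The weighted bounds for `‖grad f‖²` and `Φ` on a sublevel set of `f`. -/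
lemma weighted_bounds (hΩ : NormalizedDomain Ω) (hf : SClass Ω C f) (hP : PDE2 f 0 Ω)
    (hb : ∀ y ∈ Ω, 1 / rho f y ≤ b) (hb0 : 0 < b) (hC0 : 0 < C') (hC : C' < C)
    (hn : (10 : ℝ) ^ 7 ≤ n) {x : Fin 2 → ℝ} (hx : x ∈ Ω) (hfx : f x ≤ C') :
    Phi f x * (weight n f x * (C' - f x) ^ (n + 2)) ≤ 28 * (b ^ (n + 2) * C' ^ (n + 1)) ∧
    gradSq f f x * (weight n f x * (C' - f x) ^ n) ≤ 4 * (b ^ (n + 2) * C' ^ (n + 1)) := by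
  have hs : IsStrict Ω f := ⟨hΩ.1, hf.1, hf.2.1⟩
  set K : Set (Fin 2 → ℝ) := {x | x ∈ Ω ∧ f x ≤ C'} with hK
  have hKc : IsCompact K := isCompact_sublevel hΩ hf hC
  have hKne : K.Nonempty := ⟨x, hx, hfx⟩
  have hKΩ : K ⊆ Ω := fun y hy => hy.1
  have hcδ : ∀ m : ℕ, ContinuousOn (fun y => weight n f y * (C' - f y) ^ m) Ω := fun m =>
    hs.continuousOn_weight.mul ((continuousOn_const.sub hs.smooth.continuousOn).pow m)
  have hcA : ContinuousOn (fun y => Phi f y * (weight n f y * (C' - f y) ^ (n + 2))) Ω :=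
    hs.smooth_Phi.continuousOn.mul (hcδ _)
  have hcB : ContinuousOn (fun y => gradSq f f y * (weight n f y * (C' - f y) ^ n)) Ω :=
    hs.smooth_gradSq.continuousOn.mul (hcδ _)
  set M : ℝ := b ^ (n + 2) * C' ^ (n + 1) with hM
  have hM0 : 0 < M := by positivity
  have hδ : ∀ y ∈ K, 0 ≤ C' - f y := fun y hy => sub_nonneg.2 hy.2
  have hδw : ∀ y ∈ K, weight n f y * (C' - f y) ^ (n + 1) ≤ M := fun y hy => by
    refine mul_le_mul (hs.weight_le hb hy.1) ?_ (pow_nonneg (hδ y hy) _) (by positivity)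
    exact pow_le_pow_left₀ (hδ y hy) (by linarith [nonneg_of_sClass hΩ hf hy.1]) _
  have hA0 : ∀ y ∈ K, 0 ≤ Phi f y * (weight n f y * (C' - f y) ^ (n + 2)) := fun y hy =>
    mul_nonneg (hs.Phi_nonneg hy.1) (mul_nonneg (weight_pos _ _ _).le (pow_nonneg (hδ y hy) _))
  have hB0 : ∀ y ∈ K, 0 ≤ gradSq f f y * (weight n f y * (C' - f y) ^ n) := fun y hy =>
    mul_nonneg (hs.gradSq_nonneg hy.1)
      (mul_nonneg (weight_pos _ _ _).le (pow_nonneg (hδ y hy) _))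
  obtain ⟨a, haK, hamax⟩ := hKc.exists_isMaxOn hKne (hcA.mono hKΩ)
  obtain ⟨z, hzK, hzmax⟩ := hKc.exists_isMaxOn hKne (hcB.mono hKΩ)
  set B := gradSq f f z * (weight n f z * (C' - f z) ^ n) with hBdef
  have hBle : ∀ y ∈ K, gradSq f f y * (weight n f y * (C' - f y) ^ n) ≤ B := fun y hy => hzmax hy
  have hAle : ∀ y ∈ K, Phi f y * (weight n f y * (C' - f y) ^ (n + 2)) ≤ 4 * M + 6 * B := by
    intro y hy
    refine (hamax hy).trans ?_
    change Phi f a * (weight n f a * (C' - f a) ^ (n + 2)) ≤ 4 * M + 6 * B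
    by_cases hpos : 0 < Phi f a * (weight n f a * (C' - f a) ^ (n + 2))
    · have hΦ : 0 < Phi f a := by
        refine lt_of_le_of_ne (hs.Phi_nonneg haK.1) fun h0 => ?_
        rw [← h0, zero_mul] at hpos; exact lt_irrefl _ hpos
      have hδa : 0 < C' - f a := by
        refine lt_of_le_of_ne (hδ a haK) fun h0 => ?_
        rw [← h0, zero_pow (by omega), mul_zero, mul_zero] at hpos; exact lt_irrefl _ hpos
      have h1 := hs.Phi_le_of_isLocalMax hP haK.1 (sub_pos.1 hδa) hΦ
        (isLocalMax_of_isMaxOn_sublevel hs haK.1 (sub_pos.1 hδa) hamax)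
      have hw := weight_pos n f a
      calc Phi f a * (weight n f a * (C' - f a) ^ (n + 2))
          ≤ (4 / (C' - f a) + 6 * (gradSq f f a / (C' - f a) ^ 2)) *
            (weight n f a * (C' - f a) ^ (n + 2)) :=
            mul_le_mul_of_nonneg_right h1 (by positivity)
        _ = 4 * (weight n f a * (C' - f a) ^ (n + 1))
            + 6 * (gradSq f f a * (weight n f a * (C' - f a) ^ n)) := by
            rw [pow_add, pow_succ]; field_simp; ring
        _ ≤ 4 * M + 6 * B := by linarith [hδw a haK, hBle a haK]
    · linarith [hB0 z hzK, not_lt.1 hpos]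
  have hB4 : B ≤ 4 * M := by
    by_contra! hcon
    have hBpos : 0 < B := by linarith
    set l : ℝ := 1 / (7000 * B) with hl
    have hl0 : 0 < l := by positivity
    have hlB : l * (7 * B) = 1 / 1000 := by rw [hl]; field_simp; norm_num
    have hlA : ∀ y ∈ K, l * (Phi f y * (weight n f y * (C' - f y) ^ (n + 2))) ≤ 1 / 1000 := by
      intro y hy
      rw [← hlB]
      exact mul_le_mul_of_nonneg_left (by linarith [hAle y hy]) hl0.le
    have hcW : ContinuousOn (fun y => gradSq f f y * (weight n f y * (C' - f y) ^ n) *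
        Real.exp (l * (Phi f y * (weight n f y * (C' - f y) ^ (n + 2))))) Ω :=
      hcB.mul (continuousOn_const.mul hcA).rexp
    obtain ⟨v, hvK, hvmax⟩ := hKc.exists_isMaxOn hKne (hcW.mono hKΩ)
    have h1 : B ≤ gradSq f f v * (weight n f v * (C' - f v) ^ n) *
        Real.exp (l * (Phi f v * (weight n f v * (C' - f v) ^ (n + 2)))) :=
      le_trans (le_mul_of_one_le_right hBpos.le
        (Real.one_le_exp (mul_nonneg hl0.le (hA0 z hzK)))) (hvmax hzK)
    have hexp : Real.exp (l * (Phi f v * (weight n f v * (C' - f v) ^ (n + 2)))) ≤ 8 / 7 := by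
      refine (Real.exp_le_exp.2 (hlA v hvK)).trans ?_
      have h2 : Real.exp (1 / 1000) ≤ 1 / (1 - 1 / 1000) :=
        Real.exp_bound_div_one_sub_of_interval (by norm_num) (by norm_num)
      refine h2.trans (by norm_num)
    have h3 : B ≤ gradSq f f v * (weight n f v * (C' - f v) ^ n) * (8 / 7) :=
      h1.trans (mul_le_mul_of_nonneg_left hexp (hB0 v hvK))
    have hpos : 0 < gradSq f f v * (weight n f v * (C' - f v) ^ n) := by linarith
    have hQ : 0 < gradSq f f v := by
      refine lt_of_le_of_ne (hs.gradSq_nonneg hvK.1) fun h0 => ?_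
      rw [← h0, zero_mul] at hpos; exact lt_irrefl _ hpos
    have hn0 : n ≠ 0 := by
      rintro rfl
      norm_num at hn
    have hδv : 0 < C' - f v := by
      refine lt_of_le_of_ne (hδ v hvK) fun h0 => ?_
      rw [← h0, zero_pow hn0, mul_zero, mul_zero] at hpos; exact lt_irrefl _ hpos
    have h4 : 1 ≤ 8000 * (l * (gradSq f f v * (weight n f v * (C' - f v) ^ n))) := by
      have := mul_le_mul_of_nonneg_left h3 hl0.le
      linarith
    have h5 := hs.gradSq_le_of_isLocalMax hP hvK.1 hn (sub_pos.1 hδv) hQ hl0 (hlA v hvK) h4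
      (isLocalMax_of_isMaxOn_sublevel hs hvK.1 (sub_pos.1 hδv) hvmax)
    have hw := weight_pos n f v
    have h6 : gradSq f f v * (weight n f v * (C' - f v) ^ n) ≤ 3 * M :=
      calc gradSq f f v * (weight n f v * (C' - f v) ^ n)
          ≤ 3 * (C' - f v) * (weight n f v * (C' - f v) ^ n) :=
            mul_le_mul_of_nonneg_right h5 (by positivity)
        _ = 3 * (weight n f v * (C' - f v) ^ (n + 1)) := by rw [pow_succ]; ring
        _ ≤ 3 * M := by linarith [hδw v hvK]
    linarith
  exact ⟨by linarith [hAle x ⟨hx, hfx⟩], (hBle x ⟨hx, hfx⟩).trans hB4⟩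

lemma le_div_of_weighted {A w δ k M : ℝ} {m : ℕ} (hA : 0 ≤ A) (hw : 0 ≤ w) (hk : 0 < k)
    (hkδ : k ≤ δ) (h : A * (w * δ ^ m) ≤ M) : A * w ≤ M / k ^ m := by
  rw [le_div_iff₀ (by positivity)]
  calc A * w * k ^ m ≤ A * w * δ ^ m :=
        mul_le_mul_of_nonneg_left (pow_le_pow_left₀ hk.le hkδ m) (mul_nonneg hA hw)
    _ = A * (w * δ ^ m) := by ring
    _ ≤ M := h

end Estimate

end CalabiEstimate

/-- Proposition 3.8: for `f ∈ 𝒮(Ω,C)` on a normalized convex domain with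
`0 ∈ Ω`, solving PDE (1.2) with `β = 0`, if `1/ρ ≤ b` on `Ω`, then there is `α > 0` such
that `Φ/ρ^α ≤ d₄` and `‖grad f‖²/ρ^α ≤ d₄` on `Ω_{C/2}`, with `d₄` depending only on
`α`, `b` and `C`. -/
theorem statement14 (C b : ℝ) (hC : 0 < C) (hb : 0 < b) :
    ∃ α : ℝ, 0 < α ∧ ∃ d₄ : ℝ, 0 < d₄ ∧
      ∀ (Ω : Set (Fin 2 → ℝ)) (f : (Fin 2 → ℝ) → ℝ),
        NormalizedDomain Ω → (0 : Fin 2 → ℝ) ∈ Ω →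
        SClass Ω C f → PDE2 f 0 Ω →
        (∀ x ∈ Ω, 1 / rho f x ≤ b) →
        ∀ x ∈ Ω, f x < C / 2 →
          Phi f x / (rho f x) ^ α ≤ d₄ ∧
          gradSq f f x / (rho f x) ^ α ≤ d₄ := by
  obtain ⟨n, hn⟩ := exists_nat_ge ((10 : ℝ) ^ 7)
  set M : ℝ := b ^ (n + 2) * (3 * C / 4) ^ (n + 1) with hM
  refine ⟨(n : ℝ) + 2, by positivity,
    28 * M / (C / 4) ^ (n + 2) + 4 * M / (C / 4) ^ n, by positivity, ?_⟩
  intro Ω f hΩ _ hf hP hρ x hx hfx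
  have hs : CalabiEstimate.IsStrict Ω f := ⟨hΩ.1, hf.1, hf.2.1⟩
  obtain ⟨hA, hB⟩ := CalabiEstimate.weighted_bounds (C' := 3 * C / 4) hΩ hf hP hρ hb
    (by positivity) (by linarith) hn hx (by linarith)
  rw [hs.rho_rpow hx, hs.rho_rpow hx]
  have hk : C / 4 ≤ 3 * C / 4 - f x := by linarith
  have hw := (CalabiEstimate.weight_pos n f x).le
  constructor
  · refine (CalabiEstimate.le_div_of_weighted (hs.Phi_nonneg hx) hw (by positivity) hk hA).trans ?_
    exact le_add_of_nonneg_right (by positivity)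
  · refine (CalabiEstimate.le_div_of_weighted (hs.gradSq_nonneg hx) hw (by positivity) hk
      hB).trans ?_
    exact le_add_of_nonneg_left (by positivity)
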